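/- arXiv:1510.06833 — 3 statements merged into one kernel-verified Lean document; each statement's English description precedes it below -/
import Mathlib

section
/- Let X and Y be jointly Gaussian real random variables with mean zero, variance one and covariance r, where 0 ≤ r < 1. Then for every x > 0, P(X > x and Y > x) ≤ (1 + r) · Ψ(x) · (1 − Φ(x·√((1−r)/(1+r)))). -/
open MeasureTheory ProbabilityTheory Real Filter
open scoped Topology NNReal

/-- The standard normal density `φ(u) = (2π)^{-1/2} e^{-u²/2}`. -/
noncomputable def stdGaussianPDF (u : ℝ) : ℝ :=
  (2 * Real.pi) ^ (-(1/2) : ℝ) * Real.exp (-u ^ 2 / 2)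

/-- The standard normal cdf `Φ(u) = ∫_{-∞}^u φ(v) dv`. -/
noncomputable def stdGaussianCDF (u : ℝ) : ℝ := ∫ v in Set.Iic u, stdGaussianPDF v

/-- `Ψ(u) = φ(u)/u`. -/
noncomputable def PsiFn (u : ℝ) : ℝ := stdGaussianPDF u / u

lemma stdGaussianPDF_eq_gaussianPDFReal : stdGaussianPDF = gaussianPDFReal 0 1 := by
  funext u
  have h : (0 : ℝ) ≤ 2 * π := by positivity
  simp [stdGaussianPDF, gaussianPDFReal_def, rpow_neg h, sqrt_eq_rpow]

lemma stdGaussianCDF_eq_cdf (u : ℝ) : stdGaussianCDF u = cdf (gaussianReal 0 1) u := by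
  rw [cdf_eq_real, measureReal_def, gaussianReal_apply_eq_integral 0 one_ne_zero,
    ENNReal.toReal_ofReal (integral_nonneg fun _ => gaussianPDFReal_nonneg _ _ _),
    stdGaussianCDF, stdGaussianPDF_eq_gaussianPDFReal]

lemma stdGaussianPDF_pos (u : ℝ) : 0 < stdGaussianPDF u := by
  unfold stdGaussianPDF; positivity

lemma continuous_stdGaussianPDF : Continuous stdGaussianPDF := by
  unfold stdGaussianPDF; fun_prop

lemma integrable_stdGaussianPDF : Integrable stdGaussianPDF := by
  rw [stdGaussianPDF_eq_gaussianPDFReal]; exact integrable_gaussianPDFReal 0 1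

lemma hasDerivAt_stdGaussianPDF (u : ℝ) : HasDerivAt stdGaussianPDF (-u * stdGaussianPDF u) u := by
  have h : HasDerivAt (fun v : ℝ => -v ^ 2 / 2) (-u) u := by
    convert! ((hasDerivAt_pow 2 u).neg.div_const 2) using 1
    simp; ring
  convert! h.exp.const_mul ((2 * π) ^ (-(1/2) : ℝ)) using 1
  unfold stdGaussianPDF; ring

lemma hasDerivAt_stdGaussianCDF (u : ℝ) : HasDerivAt stdGaussianCDF (stdGaussianPDF u) u := by
  have h : HasDerivAt (fun v => stdGaussianCDF 0 + ∫ t in (0 : ℝ)..v, stdGaussianPDF t)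
      (stdGaussianPDF u) u :=
    (continuous_stdGaussianPDF.integral_hasStrictDerivAt 0 u).hasDerivAt.const_add _
  refine h.congr_of_eventuallyEq (Eventually.of_forall fun v => ?_)
  have := intervalIntegral.integral_Iic_sub_Iic (a := 0) (b := v)
    (integrable_stdGaussianPDF.integrableOn) (integrable_stdGaussianPDF.integrableOn)
  simp only [← this, stdGaussianCDF]; ring

lemma tendsto_stdGaussianPDF_atTop : Tendsto stdGaussianPDF atTop (𝓝 0) := by
  have h : Tendsto (fun u : ℝ => -u ^ 2 / 2) atTop atBot := by
    have : Tendsto (fun u : ℝ => u ^ 2 / 2) atTop atTop :=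
      (tendsto_pow_atTop two_ne_zero).atTop_div_const two_pos
    simpa only [neg_div, Function.comp_def] using tendsto_neg_atTop_atBot.comp this
  have := (tendsto_exp_atBot.comp h).const_mul ((2 * π) ^ (-(1/2) : ℝ))
  rwa [mul_zero] at this

lemma tendsto_stdGaussianCDF_atTop : Tendsto stdGaussianCDF atTop (𝓝 1) := by
  rw [funext stdGaussianCDF_eq_cdf]; exact tendsto_cdf_atTop (gaussianReal 0 1)

lemma stdGaussianCDF_nonneg (u : ℝ) : 0 ≤ stdGaussianCDF u := by
  rw [stdGaussianCDF_eq_cdf]; exact cdf_nonneg _ _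

lemma stdGaussianCDF_le_one (u : ℝ) : stdGaussianCDF u ≤ 1 := by
  rw [stdGaussianCDF_eq_cdf]; exact cdf_le_one _ _

lemma gaussianReal_Ioi_eq (u : ℝ) :
    gaussianReal 0 1 (Set.Ioi u) = ENNReal.ofReal (1 - stdGaussianCDF u) := by
  rw [← Set.compl_Iic, prob_compl_eq_one_sub measurableSet_Iic, ← ofReal_cdf,
    stdGaussianCDF_eq_cdf, ENNReal.ofReal_sub _ (cdf_nonneg _ _), ENNReal.ofReal_one]

lemma stdGaussianPDF_mul_rotation {r s : ℝ} (hs : 0 < s) (hrs : s ^ 2 = 1 - r ^ 2) (x u : ℝ) :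
    stdGaussianPDF u * stdGaussianPDF ((x - r * u) / s)
      = stdGaussianPDF x * stdGaussianPDF ((u - r * x) / s) := by
  have hexp : -u ^ 2 / 2 + -((x - r * u) / s) ^ 2 / 2
      = -x ^ 2 / 2 + -((u - r * x) / s) ^ 2 / 2 := by
    field_simp
    linear_combination (x ^ 2 - u ^ 2) * hrs
  simp only [stdGaussianPDF]
  rw [mul_mul_mul_comm, mul_mul_mul_comm _ _ _ (rexp (-((u - r * x) / s) ^ 2 / 2)), ← exp_add,
    ← exp_add, hexp]

lemma lintegral_Ioi_mul_gaussian_tail {r s : ℝ} (hs : 0 < s) (hrs : s ^ 2 = 1 - r ^ 2)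
    {x : ℝ} (hx : 0 < x) :
    ∫⁻ u in Set.Ioi x,
        ENNReal.ofReal (u * stdGaussianPDF u * (1 - stdGaussianCDF ((x - r * u) / s)))
      = ENNReal.ofReal ((1 + r) * stdGaussianPDF x * (1 - stdGaussianCDF ((x - r * x) / s))) := by
  set H : ℝ → ℝ := fun u => -(stdGaussianPDF u * (1 - stdGaussianCDF ((x - r * u) / s)))
    - r * stdGaussianPDF x * (1 - stdGaussianCDF ((u - r * x) / s)) with hH
  have hderiv : ∀ u ∈ Set.Ici x, HasDerivAt H
      (u * stdGaussianPDF u * (1 - stdGaussianCDF ((x - r * u) / s))) u := by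
    intro u _
    have h1 : HasDerivAt (fun u : ℝ => (x - r * u) / s) (-r / s) u := by
      simpa using (((hasDerivAt_id u).const_mul r).const_sub x).div_const s
    have h2 : HasDerivAt (fun u : ℝ => (u - r * x) / s) (1 / s) u :=
      ((hasDerivAt_id u).sub_const (r * x)).div_const s
    have h3 := ((hasDerivAt_stdGaussianCDF _).comp u h1).const_sub 1
    have h4 := ((hasDerivAt_stdGaussianCDF _).comp u h2).const_sub 1
    convert! ((hasDerivAt_stdGaussianPDF u).mul h3).neg.sub (h4.const_mul (r * stdGaussianPDF x))
      using 1
    simp only [Function.comp_apply]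
    linear_combination (r / s) * stdGaussianPDF_mul_rotation hs hrs x u
  have hnonneg : ∀ u ∈ Set.Ioi x,
      0 ≤ u * stdGaussianPDF u * (1 - stdGaussianCDF ((x - r * u) / s)) := fun u hu =>
    mul_nonneg (mul_nonneg (hx.trans hu).le (stdGaussianPDF_pos u).le)
      (sub_nonneg.2 (stdGaussianCDF_le_one _))
  have hlim : Tendsto H atTop (𝓝 0) := by
    have hA : Tendsto (fun u => stdGaussianPDF u * (1 - stdGaussianCDF ((x - r * u) / s)))
        atTop (𝓝 0) := by
      refine squeeze_zero (fun u => mul_nonneg (stdGaussianPDF_pos u).le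
        (sub_nonneg.2 (stdGaussianCDF_le_one _))) (fun u => ?_) tendsto_stdGaussianPDF_atTop
      exact mul_le_of_le_one_right (stdGaussianPDF_pos u).le
        (by linarith [stdGaussianCDF_nonneg ((x - r * u) / s)])
    have harg : Tendsto (fun u : ℝ => (u - r * x) / s) atTop atTop := by
      simpa only [sub_eq_add_neg, id] using
        (tendsto_atTop_add_const_right atTop (-(r * x)) tendsto_id).atTop_div_const hs
    have hB := ((tendsto_stdGaussianCDF_atTop.comp harg).const_sub 1).const_mul
      (r * stdGaussianPDF x)
    simpa [hH] using hA.neg.sub hB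
  rw [← ofReal_integral_eq_lintegral_ofReal
    (integrableOn_Ioi_deriv_of_nonneg' hderiv hnonneg hlim)
    ((ae_restrict_iff' measurableSet_Ioi).2 (Eventually.of_forall hnonneg)),
    integral_Ioi_of_hasDerivAt_of_nonneg' hderiv hnonneg hlim]
  congr 1
  simp only [hH]; ring

lemma map_prodMk_residual_eq_prod {Ω : Type*} [MeasurableSpace Ω] {P : Measure Ω}
    [IsProbabilityMeasure P] {X Y : Ω → ℝ} (hX : Measurable X) (hY : Measurable Y) {r s : ℝ}
    (hs : 0 < s) (hrs : s ^ 2 = 1 - r ^ 2)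
    (hGauss : ∀ c₁ c₂ : ℝ,
      Measure.map (fun ω => c₁ * X ω + c₂ * Y ω) P
        = gaussianReal 0 (Real.toNNReal (c₁ ^ 2 + 2 * c₁ * c₂ * r + c₂ ^ 2))) :
    P.map (fun ω => (X ω, (Y ω - r * X ω) / s)) = (gaussianReal 0 1).prod (gaussianReal 0 1) := by
  have hm : Measurable (fun ω => (X ω, (Y ω - r * X ω) / s)) := by fun_prop
  have := Measure.isProbabilityMeasure_map (μ := P) hm.aemeasurable
  refine Measure.ext_of_charFunDual (funext fun L => ?_)
  have hL : ∀ p : ℝ × ℝ, L p = L (1, 0) * p.1 + L (0, 1) * p.2 := by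
    rintro ⟨a, b⟩
    have : ((a, b) : ℝ × ℝ) = a • (1, 0) + b • (0, 1) := by simp
    rw [this, map_add, map_smul, map_smul]
    simp [mul_comm]
  set a := L (1, 0)
  set b := L (0, 1)
  have hinl : ⇑(L.comp (ContinuousLinearMap.inl ℝ ℝ ℝ)) = fun t => a * t := by
    funext t; simp [hL (t, 0)]
  have hinr : ⇑(L.comp (ContinuousLinearMap.inr ℝ ℝ ℝ)) = fun t => b * t := by
    funext t; simp [hL (0, t)]
  rw [charFunDual_prod, charFunDual_eq_charFun_map_one, charFunDual_eq_charFun_map_one,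
    charFunDual_eq_charFun_map_one, hinl, hinr, gaussianReal_map_const_mul,
    gaussianReal_map_const_mul, Measure.map_map L.continuous.measurable hm]
  have hcomp : ⇑L ∘ (fun ω => (X ω, (Y ω - r * X ω) / s))
      = fun ω => (a - b * r / s) * X ω + b / s * Y ω := by
    funext ω
    simp only [Function.comp_apply, hL]
    ring
  have hvar : (a - b * r / s) ^ 2 + 2 * (a - b * r / s) * (b / s) * r + (b / s) ^ 2
      = a ^ 2 + b ^ 2 := by
    field_simp
    linear_combination (-b ^ 2) * hrs
  rw [hcomp, hGauss, hvar, charFun_gaussianReal, charFun_gaussianReal, charFun_gaussianReal,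
    ← Complex.exp_add]
  congr 1
  rw [Real.coe_toNNReal _ (by positivity)]
  push_cast
  simp
  ring

/-- Lemma 2.3 of Pickands, 1969: Let `X, Y` be jointly Gaussian, mean zero,
variance one, covariance `r` with `0 ≤ r < 1` (joint Gaussianity encoded by: every linear
combination `c₁X + c₂Y` is Gaussian with mean `0` and variance `c₁² + 2c₁c₂r + c₂²`).
Then for every `x > 0`,
`P(X > x, Y > x) ≤ (1+r) Ψ(x) (1 − Φ(x √((1−r)/(1+r))))`. -/
theorem stmt0 {Ω : Type*} [MeasurableSpace Ω] (P : Measure Ω) [IsProbabilityMeasure P]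
    (X Y : Ω → ℝ) (hX : Measurable X) (hY : Measurable Y) (r : ℝ)
    (hr0 : 0 ≤ r) (hr1 : r < 1)
    (hGauss : ∀ c₁ c₂ : ℝ,
      Measure.map (fun ω => c₁ * X ω + c₂ * Y ω) P
        = gaussianReal 0 (Real.toNNReal (c₁ ^ 2 + 2 * c₁ * c₂ * r + c₂ ^ 2)))
    (x : ℝ) (hx : 0 < x) :
    (P {ω | x < X ω ∧ x < Y ω}).toReal
      ≤ (1 + r) * PsiFn x * (1 - stdGaussianCDF (x * Real.sqrt ((1 - r) / (1 + r)))) := by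
  have hr2 : 0 < 1 - r ^ 2 := by nlinarith
  set s := √(1 - r ^ 2) with hs_def
  have hs : 0 < s := sqrt_pos.2 hr2
  have hrs : s ^ 2 = 1 - r ^ 2 := sq_sqrt hr2.le
  have harg : x * √((1 - r) / (1 + r)) = (x - r * x) / s := by
    have : √((1 - r) / (1 + r)) = (1 - r) / s := by
      rw [sqrt_eq_iff_mul_self_eq_of_pos (by have := sub_pos.2 hr1; positivity)]
      have h1 : 1 + r ≠ 0 := by positivity
      field_simp
      rw [hrs]; ring
    rw [this]; ring
  have hset : MeasurableSet {p : ℝ × ℝ | x < p.1 ∧ x < r * p.1 + s * p.2} :=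
    (measurableSet_lt measurable_const measurable_fst).inter
      (measurableSet_lt measurable_const
        (by fun_prop : Measurable fun p : ℝ × ℝ => r * p.1 + s * p.2))
  have hpre : {ω | x < X ω ∧ x < Y ω} = (fun ω => (X ω, (Y ω - r * X ω) / s)) ⁻¹'
      {p : ℝ × ℝ | x < p.1 ∧ x < r * p.1 + s * p.2} := by
    ext ω
    simp [mul_div_cancel₀ _ hs.ne']
  have hslice : ∀ u : ℝ, gaussianPDF 0 1 u * gaussianReal 0 1
      (Prod.mk u ⁻¹' {p : ℝ × ℝ | x < p.1 ∧ x < r * p.1 + s * p.2})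
      = (Set.Ioi x).indicator (fun u => ENNReal.ofReal
        (stdGaussianPDF u * (1 - stdGaussianCDF ((x - r * u) / s)))) u := by
    intro u
    by_cases hu : x < u
    · have : Prod.mk u ⁻¹' {p : ℝ × ℝ | x < p.1 ∧ x < r * p.1 + s * p.2}
          = Set.Ioi ((x - r * u) / s) := by
        ext v
        simp [hu, div_lt_iff₀ hs, sub_lt_iff_lt_add', mul_comm]
      rw [this, gaussianReal_Ioi_eq, Set.indicator_of_mem (Set.mem_Ioi.2 hu), gaussianPDF,
        ← stdGaussianPDF_eq_gaussianPDFReal, ENNReal.ofReal_mul (stdGaussianPDF_pos u).le]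
    · simp [hu]
  have hprob : P {ω | x < X ω ∧ x < Y ω} = ∫⁻ u in Set.Ioi x,
      ENNReal.ofReal (stdGaussianPDF u * (1 - stdGaussianCDF ((x - r * u) / s))) := by
    rw [hpre, ← Measure.map_apply (by fun_prop) hset,
      map_prodMk_residual_eq_prod hX hY hs hrs hGauss, Measure.prod_apply hset]
    conv_lhs => rw [gaussianReal_of_var_ne_zero 0 one_ne_zero]
    rw [lintegral_withDensity_eq_lintegral_mul _ (measurable_gaussianPDF 0 1)
      (by rw [← gaussianReal_of_var_ne_zero 0 one_ne_zero]
          exact measurable_measure_prodMk_left hset), ← lintegral_indicator measurableSet_Ioi]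
    refine lintegral_congr fun u => ?_
    rw [← hslice u, Pi.mul_apply, gaussianReal_of_var_ne_zero 0 one_ne_zero]
  rw [harg]
  have htail : 0 ≤ 1 - stdGaussianCDF ((x - r * x) / s) := sub_nonneg.2 (stdGaussianCDF_le_one _)
  have hφ := stdGaussianPDF_pos x
  refine ENNReal.toReal_le_of_le_ofReal (by unfold PsiFn; positivity) ?_
  have hle : P {ω | x < X ω ∧ x < Y ω} ≤ ENNReal.ofReal x⁻¹ * ∫⁻ u in Set.Ioi x,
      ENNReal.ofReal (u * stdGaussianPDF u * (1 - stdGaussianCDF ((x - r * u) / s))) := by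
    rw [hprob, ← lintegral_const_mul' _ _ ENNReal.ofReal_ne_top]
    refine setLIntegral_mono' measurableSet_Ioi fun u hu => ?_
    rw [← ENNReal.ofReal_mul (by positivity)]
    refine ENNReal.ofReal_le_ofReal ?_
    have h0 : 0 ≤ stdGaussianPDF u * (1 - stdGaussianCDF ((x - r * u) / s)) :=
      mul_nonneg (stdGaussianPDF_pos u).le (sub_nonneg.2 (stdGaussianCDF_le_one _))
    have h1 : 1 ≤ x⁻¹ * u := by
      rw [inv_mul_eq_div, one_le_div hx]; exact (Set.mem_Ioi.1 hu).le
    calc _ ≤ (x⁻¹ * u) * (stdGaussianPDF u * (1 - stdGaussianCDF ((x - r * u) / s))) :=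
          le_mul_of_one_le_left h0 h1
      _ = _ := by ring
  refine hle.trans_eq ?_
  rw [lintegral_Ioi_mul_gaussian_tail hs hrs hx, ← ENNReal.ofReal_mul (by positivity)]
  congr 1
  unfold PsiFn; ring
end

section
/- (Slepian's lemma, finite-dimensional form.) Let N ≥ 1, let μ ∈ ℝ^N, and let Σ_X = (r_X(i,j)) and Σ_Y = (r_Y(i,j)) be N×N positive semidefinite matrices with r_X(i,i) = r_Y(i,i) for all i and r_X(i,j) ≤ r_Y(i,j) for all i,j. Let X = (X_1,…,X_N) be a Gaussian random vector with mean μ and covariance matrix Σ_X, and Y = (Y_1,…,Y_N) a Gaussian random vector with mean μ and covariance matrix Σ_Y. Then for every x ∈ ℝ, P(max_{1≤i≤N} X_i < x) ≤ P(max_{1≤i≤N} Y_i < x). -/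
open MeasureTheory ProbabilityTheory Real
open scoped NNReal

section Analysis

variable {ι : Type*} [Fintype ι]

lemma contDiff_prod_coord {g : ℝ → ℝ} {n : ℕ} (hg : ContDiff ℝ n g) :
    ContDiff ℝ n (fun v : EuclideanSpace ℝ ι ↦ ∏ i, g (v i)) :=
  contDiff_prod fun i _ ↦ hg.comp (EuclideanSpace.proj (𝕜 := ℝ) i).contDiff

lemma exists_norm_iteratedFDeriv_prod_coord_le {g : ℝ → ℝ} {n : ℕ} (hg : ContDiff ℝ n g)
    (hb : ∀ k, ∃ C, ∀ y, ‖iteratedFDeriv ℝ k g y‖ ≤ C) :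
    ∃ C, ∀ w : EuclideanSpace ℝ ι,
      ‖iteratedFDeriv ℝ n (fun v : EuclideanSpace ℝ ι ↦ ∏ i, g (v i)) w‖ ≤ C := by
  classical
  have hcoord (i : ι) (k : ℕ) (hk : k ≤ n) : ∃ C, ∀ w : EuclideanSpace ℝ ι,
      ‖iteratedFDeriv ℝ k (fun v : EuclideanSpace ℝ ι ↦ g (v i)) w‖ ≤ C := by
    obtain ⟨C, hC⟩ := hb k
    refine ⟨C * ∏ _j : Fin k, ‖(EuclideanSpace.proj i : EuclideanSpace ℝ ι →L[ℝ] ℝ)‖, fun w ↦ ?_⟩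
    have h := (EuclideanSpace.proj i : EuclideanSpace ℝ ι →L[ℝ] ℝ).iteratedFDeriv_comp_right
      hg w (by exact_mod_cast hk : (k : WithTop ℕ∞) ≤ n)
    have h' := ((iteratedFDeriv ℝ k g (w i)).norm_compContinuousLinearMap_le
      fun _ ↦ (EuclideanSpace.proj i : EuclideanSpace ℝ ι →L[ℝ] ℝ))
    change ‖iteratedFDeriv ℝ k (g ∘ (EuclideanSpace.proj i : EuclideanSpace ℝ ι →L[ℝ] ℝ)) w‖ ≤ _
    rw [h]
    refine h'.trans ?_
    gcongr
    exact hC _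
  choose! B hB using hcoord
  refine ⟨∑ p ∈ (Finset.univ : Finset ι).sym n, ((p : Multiset ι).countPerms : ℝ) *
    ∏ j, B j ((p : Multiset ι).count j), fun w ↦ ?_⟩
  refine (norm_iteratedFDeriv_prod_le (N := n)
    (fun i _ ↦ hg.comp (EuclideanSpace.proj (𝕜 := ℝ) i).contDiff) le_rfl).trans ?_
  gcongr with p hp j hj
  exact hB j _ ((Multiset.count_le_card _ _).trans p.2.le) w

lemma abs_taylor_two_sub_le {E : Type*} [NormedAddCommGroup E] [NormedSpace ℝ E] {F : E → ℝ}
    (hF : ContDiff ℝ 3 F) {C : ℝ} (hC : ∀ w, ‖iteratedFDeriv ℝ 3 F w‖ ≤ C) (w z : E) :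
    |F (w + z) - (F w + fderiv ℝ F w z + fderiv ℝ (fderiv ℝ F) w z z / 2)| ≤ C / 2 * ‖z‖ ^ 3 := by
  have h := map_add_eq_sum_add_integral_iteratedFDeriv (f := F) (x := w) (y := z) (n := 2)
    (fun t _ ↦ by exact_mod_cast hF.contDiffAt)
  have hr : ‖∫ t in (0 : ℝ)..1, (1 - t) ^ 2 • iteratedFDeriv ℝ (2 + 1) F (w + t • z) (fun _ ↦ z)‖
      ≤ C * ‖z‖ ^ 3 * |1 - 0| := by
    refine intervalIntegral.norm_integral_le_of_norm_le_const fun t ht ↦ ?_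
    rw [Set.uIoc_of_le zero_le_one] at ht
    have h1 : ‖(1 - t) ^ 2‖ ≤ 1 := by
      rw [norm_pow, Real.norm_eq_abs]
      exact pow_le_one₀ (abs_nonneg _) (abs_le.2 ⟨by linarith [ht.2], by linarith [ht.1]⟩)
    have h2 := (iteratedFDeriv ℝ 3 F (w + t • z)).le_opNorm (fun _ ↦ z)
    simp only [Finset.prod_const, Finset.card_univ, Fintype.card_fin] at h2
    rw [norm_smul]
    calc _ ≤ 1 * (‖iteratedFDeriv ℝ 3 F (w + t • z)‖ * ‖z‖ ^ 3) := by gcongr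
      _ ≤ C * ‖z‖ ^ 3 := by rw [one_mul]; gcongr; exact hC _
  simp only [Finset.sum_range_succ, Finset.sum_range_zero, iteratedFDeriv_zero_apply,
    iteratedFDeriv_one_apply, iteratedFDeriv_two_apply] at h
  rw [h]
  rw [Real.norm_eq_abs, abs_le] at hr
  norm_num [Nat.factorial] at hr ⊢
  rw [abs_le]
  constructor <;> linarith

variable [DecidableEq ι]

lemma fderiv_prod_coord_single {g : ℝ → ℝ} (hg : Differentiable ℝ g) (w : EuclideanSpace ℝ ι)
    (j : ι) : fderiv ℝ (fun v : EuclideanSpace ℝ ι ↦ ∏ i, g (v i)) w (EuclideanSpace.single j 1)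
      = deriv g (w j) * ∏ i ∈ Finset.univ.erase j, g (w i) := by
  have hd : Differentiable ℝ (fun v : EuclideanSpace ℝ ι ↦ ∏ i, g (v i)) := by fun_prop
  rw [← (hd w).lineDeriv_eq_fderiv, lineDeriv]
  have : (fun t : ℝ ↦ ∏ i, g ((w + t • EuclideanSpace.single j (1 : ℝ)) i))
      = fun t ↦ g (w j + t) * ∏ i ∈ Finset.univ.erase j, g (w i) := by
    ext t
    rw [← Finset.mul_prod_erase _ _ (Finset.mem_univ j)]
    congr 1
    · simp
    · exact Finset.prod_congr rfl fun i hi ↦ by simp [Finset.ne_of_mem_erase hi]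
  rw [this, deriv_mul_const (by fun_prop), deriv_comp_const_add]
  simp

lemma fderiv_fderiv_prod_coord_nonneg {g : ℝ → ℝ} (hg : ContDiff ℝ 2 g) (hanti : Antitone g)
    (h0 : ∀ y, 0 ≤ g y) (w : EuclideanSpace ℝ ι) {i j : ι} (hij : i ≠ j) :
    0 ≤ fderiv ℝ (fderiv ℝ (fun v : EuclideanSpace ℝ ι ↦ ∏ i, g (v i))) w
      (EuclideanSpace.single i 1) (EuclideanSpace.single j 1) := by
  have hF : ContDiff ℝ 2 (fun v : EuclideanSpace ℝ ι ↦ ∏ i, g (v i)) := contDiff_prod_coord hg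
  have hd : Differentiable ℝ (fderiv ℝ (fun v : EuclideanSpace ℝ ι ↦ ∏ i, g (v i))) :=
    (hF.fderiv_right (m := 1) (by norm_num)).differentiable (by norm_num)
  have hgd : Differentiable ℝ g := hg.differentiable (by norm_num)
  have h1 : fderiv ℝ (fderiv ℝ (fun v : EuclideanSpace ℝ ι ↦ ∏ i, g (v i))) w
      (EuclideanSpace.single i 1) (EuclideanSpace.single j 1)
      = fderiv ℝ (fun v ↦ fderiv ℝ (fun v : EuclideanSpace ℝ ι ↦ ∏ i, g (v i)) v
        (EuclideanSpace.single j 1)) w (EuclideanSpace.single i 1) := by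
    rw [fderiv_clm_apply (hd w) (by fun_prop)]
    simp
  rw [h1, ← DifferentiableAt.lineDeriv_eq_fderiv (by fun_prop), lineDeriv]
  simp_rw [fderiv_prod_coord_single hgd]
  refine Monotone.deriv_nonneg fun s t hst ↦ ?_
  have hmem : i ∈ Finset.univ.erase j := by simp [hij]
  simp only [PiLp.add_apply, PiLp.smul_apply, PiLp.single_apply, hij.symm, if_false,
    smul_zero, add_zero]
  refine mul_le_mul_of_nonpos_left ?_ hanti.deriv_nonpos
  refine Finset.prod_le_prod (fun k _ ↦ h0 _) fun k _ ↦ hanti ?_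
  split_ifs <;> simp [hst]

lemma exists_norm_iteratedFDeriv_smoothTransition_le {a : ℝ} (ha : 0 < a) (x : ℝ) (k : ℕ) :
    ∃ C, ∀ y, ‖iteratedFDeriv ℝ k (fun y ↦ smoothTransition (a * (x - y))) y‖ ≤ C := by
  have hsm : ContDiff ℝ (k : ℕ) (fun y ↦ smoothTransition (a * (x - y))) :=
    (smoothTransition.contDiff (n := (k : ℕ∞))).comp (by fun_prop)
  cases k with
  | zero =>
    refine ⟨1, fun y ↦ ?_⟩
    rw [norm_iteratedFDeriv_zero, Real.norm_of_nonneg (smoothTransition.nonneg _)]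
    exact smoothTransition.le_one _
  | succ k =>
    have hsupp : HasCompactSupport (fderiv ℝ fun y ↦ smoothTransition (a * (x - y))) := by
      refine HasCompactSupport.intro (isCompact_Icc (a := x - 1 / a) (b := x)) fun y hy ↦ ?_
      rw [Set.mem_Icc, not_and_or, not_le, not_le] at hy
      rcases hy with hy | hy
      · have : (fun y ↦ smoothTransition (a * (x - y))) =ᶠ[nhds y] fun _ ↦ 1 := by
          filter_upwards [gt_mem_nhds hy] with z hz
          refine smoothTransition.one_of_one_le ?_
          have : 1 / a ≤ x - z := by linarith
          rwa [div_le_iff₀' ha] at this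
        rw [this.fderiv_eq]; simp
      · have : (fun y ↦ smoothTransition (a * (x - y))) =ᶠ[nhds y] fun _ ↦ 0 := by
          filter_upwards [lt_mem_nhds hy] with z hz
          exact smoothTransition.zero_of_nonpos
            (mul_nonpos_of_nonneg_of_nonpos ha.le (by linarith))
        rw [this.fderiv_eq]; simp
    have hc : Continuous (iteratedFDeriv ℝ k (fderiv ℝ fun y ↦ smoothTransition (a * (x - y)))) :=
      (hsm.fderiv_right (m := k) (by norm_cast)).continuous_iteratedFDeriv le_rfl
    obtain ⟨C, hC⟩ := (hsupp.iteratedFDeriv (𝕜 := ℝ) k).exists_bound_of_continuous hc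
    exact ⟨C, fun y ↦ by rw [← norm_iteratedFDeriv_fderiv]; exact hC y⟩

end Analysis

section Gaussian

variable {ι : Type*} [Fintype ι] [DecidableEq ι]

lemma multivariateGaussian_add_smul_eq_conv (m : EuclideanSpace ℝ ι) {B S : Matrix ι ι ℝ}
    (hB : B.PosSemidef) (hS : S.PosSemidef) (h : ℝ) :
    multivariateGaussian m (B + h ^ 2 • S)
      = (multivariateGaussian m B) ∗ ((multivariateGaussian 0 S).map (h • ·)) := by
  have : IsProbabilityMeasure ((multivariateGaussian 0 S).map (h • ·)) :=
    Measure.isProbabilityMeasure_map (by fun_prop)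
  refine Measure.ext_of_charFun (funext fun t ↦ ?_)
  rw [charFun_conv, charFun_map_smul, charFun_multivariateGaussian hB,
    charFun_multivariateGaussian hS,
    charFun_multivariateGaussian (hB.add (hS.smul (sq_nonneg h))), ← Complex.exp_add]
  congr 1
  simp only [inner_zero_right, Matrix.add_mulVec, dotProduct_add, Matrix.smul_mulVec,
    dotProduct_smul, WithLp.ofLp_smul, Matrix.mulVec_smul, smul_dotProduct, smul_eq_mul]
  push_cast
  ring

lemma integral_multivariateGaussian_add_smul (m : EuclideanSpace ℝ ι) {B S : Matrix ι ι ℝ}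
    (hB : B.PosSemidef) (hS : S.PosSemidef) (h : ℝ) {F : EuclideanSpace ℝ ι → ℝ}
    (hF : Continuous F) {K : ℝ} (hK : ∀ v, ‖F v‖ ≤ K) :
    ∫ v, F v ∂(multivariateGaussian m (B + h ^ 2 • S))
      = ∫ w, ∫ z, F (w + h • z) ∂(multivariateGaussian 0 S) ∂(multivariateGaussian m B) := by
  have : IsProbabilityMeasure ((multivariateGaussian 0 S).map (h • ·)) :=
    Measure.isProbabilityMeasure_map (by fun_prop)
  rw [multivariateGaussian_add_smul_eq_conv m hB hS, integral_conv]
  · congr 1 with w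
    rw [integral_map (by fun_prop) (by fun_prop)]
  · exact Integrable.of_bound hF.aestronglyMeasurable K (ae_of_all _ hK)

lemma memLp_eval_multivariateGaussian (m : EuclideanSpace ℝ ι) (S : Matrix ι ι ℝ) (i : ι) :
    MemLp (fun z : EuclideanSpace ℝ ι ↦ z i) 2 (multivariateGaussian m S) :=
  (EuclideanSpace.proj i : EuclideanSpace ℝ ι →L[ℝ] ℝ).comp_memLp' IsGaussian.memLp_two_id

lemma integral_eval_multivariateGaussian_zero (S : Matrix ι ι ℝ) (i : ι) :
    ∫ z, z i ∂(multivariateGaussian 0 S) = 0 := by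
  have := (EuclideanSpace.proj i : EuclideanSpace ℝ ι →L[ℝ] ℝ).integral_comp_comm
    (μ := multivariateGaussian 0 S) IsGaussian.integrable_fun_id
  simpa using this

lemma integral_clm_multivariateGaussian_zero (S : Matrix ι ι ℝ)
    (L : EuclideanSpace ℝ ι →L[ℝ] ℝ) : ∫ z, L z ∂(multivariateGaussian 0 S) = 0 := by
  rw [L.integral_comp_comm IsGaussian.integrable_fun_id]
  simp

lemma bilin_apply_self_eq_sum (H : EuclideanSpace ℝ ι →L[ℝ] EuclideanSpace ℝ ι →L[ℝ] ℝ)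
    (z : EuclideanSpace ℝ ι) :
    H z z = ∑ i, ∑ j, z i * z j * H (EuclideanSpace.single i 1) (EuclideanSpace.single j 1) := by
  have hz : z = ∑ i, z i • EuclideanSpace.single i (1 : ℝ) := by
    simpa using ((EuclideanSpace.basisFun ι ℝ).sum_repr z).symm
  conv_lhs => rw [hz]
  simp only [map_sum, map_smul, sum_apply, smul_apply,
    smul_eq_mul, Finset.mul_sum]
  rw [Finset.sum_comm]
  exact Finset.sum_congr rfl fun i _ ↦ Finset.sum_congr rfl fun j _ ↦ by ring

lemma integrable_eval_mul_eval (S : Matrix ι ι ℝ) (i j : ι) :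
    Integrable (fun z : EuclideanSpace ℝ ι ↦ z i * z j) (multivariateGaussian 0 S) :=
  (memLp_eval_multivariateGaussian 0 S i).integrable_mul (memLp_eval_multivariateGaussian 0 S j)

lemma integrable_bilin_multivariateGaussian (S : Matrix ι ι ℝ)
    (H : EuclideanSpace ℝ ι →L[ℝ] EuclideanSpace ℝ ι →L[ℝ] ℝ) :
    Integrable (fun z ↦ H z z) (multivariateGaussian 0 S) := by
  simp_rw [bilin_apply_self_eq_sum H]
  exact integrable_finsetSum _ fun i _ ↦ integrable_finsetSum _ fun j _ ↦
    (integrable_eval_mul_eval S i j).mul_const _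

lemma integral_bilin_multivariateGaussian {S : Matrix ι ι ℝ} (hS : S.PosSemidef)
    (H : EuclideanSpace ℝ ι →L[ℝ] EuclideanSpace ℝ ι →L[ℝ] ℝ) :
    ∫ z, H z z ∂(multivariateGaussian 0 S)
      = ∑ i, ∑ j, S i j * H (EuclideanSpace.single i 1) (EuclideanSpace.single j 1) := by
  have hint (i j : ι) := (integrable_eval_mul_eval S i j).mul_const
    (H (EuclideanSpace.single i 1) (EuclideanSpace.single j 1))
  simp_rw [bilin_apply_self_eq_sum H]
  rw [integral_finsetSum _ fun i _ ↦ integrable_finsetSum _ fun j _ ↦ hint i j]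
  refine Finset.sum_congr rfl fun i _ ↦ ?_
  rw [integral_finsetSum _ fun j _ ↦ hint i j]
  refine Finset.sum_congr rfl fun j _ ↦ ?_
  rw [integral_mul_const, ← covariance_eval_multivariateGaussian (μ := 0) hS i j,
    covariance_eq_sub (memLp_eval_multivariateGaussian 0 S i)
      (memLp_eval_multivariateGaussian 0 S j)]
  simp [integral_eval_multivariateGaussian_zero]

lemma integrable_norm_pow_three_multivariateGaussian (S : Matrix ι ι ℝ) :
    Integrable (fun z : EuclideanSpace ℝ ι ↦ ‖z‖ ^ 3) (multivariateGaussian 0 S) :=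
  (IsGaussian.memLp_id (multivariateGaussian 0 S) 3 (by norm_num)).integrable_norm_pow
    (p := 3) (by norm_num)

lemma abs_integral_add_smul_sub_le {S : Matrix ι ι ℝ} (hS : S.PosSemidef)
    {F : EuclideanSpace ℝ ι → ℝ} (hF : ContDiff ℝ 3 F) {K C : ℝ} (hK : ∀ v, ‖F v‖ ≤ K)
    (hC : ∀ w, ‖iteratedFDeriv ℝ 3 F w‖ ≤ C) (w : EuclideanSpace ℝ ι) {h : ℝ} (hh : 0 ≤ h) :
    |∫ z, F (w + h • z) ∂(multivariateGaussian 0 S)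
      - (F w + h ^ 2 / 2 * ∑ i, ∑ j, S i j * fderiv ℝ (fderiv ℝ F) w
          (EuclideanSpace.single i 1) (EuclideanSpace.single j 1))|
      ≤ C / 2 * h ^ 3 * ∫ z, ‖z‖ ^ 3 ∂(multivariateGaussian 0 S) := by
  set ν := multivariateGaussian 0 S
  have h1 : Integrable (fun z ↦ F (w + h • z)) ν :=
    Integrable.of_bound (hF.continuous.comp (by fun_prop)).aestronglyMeasurable K
      (ae_of_all _ fun z ↦ hK _)
  have h2 : Integrable (fun z ↦ fderiv ℝ F w z) ν :=
    (fderiv ℝ F w).integrable_comp IsGaussian.integrable_fun_id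
  have h3 : Integrable (fun z ↦ fderiv ℝ (fderiv ℝ F) w z z) ν :=
    integrable_bilin_multivariateGaussian S _
  have hpoly : Integrable (fun z ↦ F w + h * fderiv ℝ F w z
      + h ^ 2 / 2 * fderiv ℝ (fderiv ℝ F) w z z) ν :=
    ((integrable_const _).add (h2.const_mul h)).add (h3.const_mul _)
  have heq : F w + h ^ 2 / 2 * ∑ i, ∑ j, S i j * fderiv ℝ (fderiv ℝ F) w
      (EuclideanSpace.single i 1) (EuclideanSpace.single j 1)
      = ∫ z, (F w + h * fderiv ℝ F w z + h ^ 2 / 2 * fderiv ℝ (fderiv ℝ F) w z z) ∂ν := by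
    have e1 : ∫ z, (F w + h * fderiv ℝ F w z + h ^ 2 / 2 * fderiv ℝ (fderiv ℝ F) w z z) ∂ν
        = ∫ z, (F w + h * fderiv ℝ F w z) ∂ν
          + ∫ z, h ^ 2 / 2 * fderiv ℝ (fderiv ℝ F) w z z ∂ν :=
      integral_add ((integrable_const _).add (h2.const_mul h)) (h3.const_mul _)
    have e2 : ∫ z, (F w + h * fderiv ℝ F w z) ∂ν
        = ∫ _, F w ∂ν + ∫ z, h * fderiv ℝ F w z ∂ν :=
      integral_add (integrable_const _) (h2.const_mul h)
    rw [e1, e2, integral_const_mul, integral_const_mul,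
      integral_bilin_multivariateGaussian hS, integral_clm_multivariateGaussian_zero]
    simp
  rw [heq, ← integral_sub h1 hpoly, ← integral_const_mul]
  refine abs_integral_le_integral_abs.trans (integral_mono (h1.sub hpoly).abs
    ((integrable_norm_pow_three_multivariateGaussian S).const_mul _) fun z ↦ ?_)
  have := abs_taylor_two_sub_le hF hC w (h • z)
  simp only [map_smul, smul_apply, smul_eq_mul, norm_smul,
    Real.norm_of_nonneg hh] at this
  change |F (w + h • z) - (F w + h * fderiv ℝ F w z + h ^ 2 / 2 * fderiv ℝ (fderiv ℝ F) w z z)|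
    ≤ C / 2 * h ^ 3 * ‖z‖ ^ 3
  calc _ = _ := by congr 1; ring
    _ ≤ _ := this
    _ = _ := by ring

lemma sub_le_integral_add_smul_sub {S T : Matrix ι ι ℝ} (hS : S.PosSemidef) (hT : T.PosSemidef)
    (hdiag : ∀ i, S i i = T i i) (hle : ∀ i j, S i j ≤ T i j)
    {F : EuclideanSpace ℝ ι → ℝ} (hF : ContDiff ℝ 3 F) {K C : ℝ} (hK : ∀ v, ‖F v‖ ≤ K)
    (hC : ∀ w, ‖iteratedFDeriv ℝ 3 F w‖ ≤ C)
    (hpos : ∀ w i j, i ≠ j → 0 ≤ fderiv ℝ (fderiv ℝ F) w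
      (EuclideanSpace.single i 1) (EuclideanSpace.single j 1))
    (w : EuclideanSpace ℝ ι) {h : ℝ} (hh : 0 ≤ h) :
    -(C / 2 * (∫ z, ‖z‖ ^ 3 ∂(multivariateGaussian 0 S)
        + ∫ z, ‖z‖ ^ 3 ∂(multivariateGaussian 0 T))) * h ^ 3
      ≤ ∫ z, F (w + h • z) ∂(multivariateGaussian 0 T)
        - ∫ z, F (w + h • z) ∂(multivariateGaussian 0 S) := by
  have h1 := (abs_le.1 (abs_integral_add_smul_sub_le hS hF hK hC w hh)).2
  have h2 := (abs_le.1 (abs_integral_add_smul_sub_le hT hF hK hC w hh)).1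
  have h3 : ∑ i, ∑ j, S i j * fderiv ℝ (fderiv ℝ F) w
        (EuclideanSpace.single i 1) (EuclideanSpace.single j 1)
      ≤ ∑ i, ∑ j, T i j * fderiv ℝ (fderiv ℝ F) w
        (EuclideanSpace.single i 1) (EuclideanSpace.single j 1) := by
    refine Finset.sum_le_sum fun i _ ↦ Finset.sum_le_sum fun j _ ↦ ?_
    rcases eq_or_ne i j with rfl | hij
    · rw [hdiag]
    · exact mul_le_mul_of_nonneg_right (hle i j) (hpos w i j hij)
  have h4 := mul_le_mul_of_nonneg_left h3 (by positivity : 0 ≤ h ^ 2 / 2)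
  linarith

lemma integral_multivariateGaussian_mono (m : EuclideanSpace ℝ ι) {S T : Matrix ι ι ℝ}
    (hS : S.PosSemidef) (hT : T.PosSemidef)
    (hdiag : ∀ i, S i i = T i i) (hle : ∀ i j, S i j ≤ T i j)
    {F : EuclideanSpace ℝ ι → ℝ} (hF : ContDiff ℝ 3 F) {K C : ℝ} (hK : ∀ v, ‖F v‖ ≤ K)
    (hC : ∀ w, ‖iteratedFDeriv ℝ 3 F w‖ ≤ C)
    (hpos : ∀ w i j, i ≠ j → 0 ≤ fderiv ℝ (fderiv ℝ F) w
      (EuclideanSpace.single i 1) (EuclideanSpace.single j 1)) :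
    ∫ v, F v ∂(multivariateGaussian m S) ≤ ∫ v, F v ∂(multivariateGaussian m T) := by
  set M := C / 2 * (∫ z, ‖z‖ ^ 3 ∂(multivariateGaussian 0 S)
        + ∫ z, ‖z‖ ^ 3 ∂(multivariateGaussian 0 T))
  have hint (A : Matrix ι ι ℝ) (h : ℝ) (B : Matrix ι ι ℝ) : Integrable
      (fun w ↦ ∫ z, F (w + h • z) ∂(multivariateGaussian 0 A)) (multivariateGaussian m B) := by
    refine Integrable.of_bound (C := K) ?_ (ae_of_all _ fun w ↦ ?_)
    · refine StronglyMeasurable.aestronglyMeasurable ?_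
      refine StronglyMeasurable.integral_prod_right
        (f := fun w z : EuclideanSpace ℝ ι ↦ F (w + h • z)) ?_
      exact (hF.continuous.comp (by fun_prop)).stronglyMeasurable
    · simpa using norm_integral_le_of_norm_le_const (μ := multivariateGaussian 0 A)
        (ae_of_all _ fun z ↦ hK (w + h • z))
  have hstep (B : Matrix ι ι ℝ) (hB : B.PosSemidef) (h : ℝ) (hh : 0 ≤ h) :
      -M * h ^ 3 ≤ ∫ v, F v ∂(multivariateGaussian m (B + h ^ 2 • T))
        - ∫ v, F v ∂(multivariateGaussian m (B + h ^ 2 • S)) := by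
    rw [integral_multivariateGaussian_add_smul m hB hT h hF.continuous hK,
      integral_multivariateGaussian_add_smul m hB hS h hF.continuous hK,
      ← integral_sub (hint T h B) (hint S h B)]
    have := integral_mono (integrable_const (-M * h ^ 3)) ((hint T h B).sub (hint S h B))
      fun w ↦ sub_le_integral_add_smul_sub hS hT hdiag hle hF hK hC hpos w hh
    simpa using this
  have hbound (n : ℕ) : -M * √(1 / ((n : ℝ) + 1)) ≤ ∫ v, F v ∂(multivariateGaussian m T)
      - ∫ v, F v ∂(multivariateGaussian m S) := by
    have hn : (0 : ℝ) < n + 1 := by positivity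
    set h := √(1 / ((n : ℝ) + 1))
    have hh : h ^ 2 = 1 / ((n : ℝ) + 1) := Real.sq_sqrt (by positivity)
    let A (k : ℕ) : Matrix ι ι ℝ := (1 - k / ((n : ℝ) + 1)) • S + (k / ((n : ℝ) + 1)) • T
    have hA (k : ℕ) (hk : k ∈ Finset.range (n + 1)) : -M * h ^ 3
        ≤ ∫ v, F v ∂(multivariateGaussian m (A (k + 1)))
          - ∫ v, F v ∂(multivariateGaussian m (A k)) := by
      have hk' : ((k : ℝ) + 1) / (n + 1) ≤ 1 := by
        rw [div_le_one hn]
        exact_mod_cast Finset.mem_range.1 hk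
      have hB := (hS.smul (sub_nonneg.2 hk')).add
        (hT.smul (by positivity : 0 ≤ (k : ℝ) / (n + 1)))
      have eT : A (k + 1) = (1 - ((k : ℝ) + 1) / (n + 1)) • S + ((k : ℝ) / (n + 1)) • T
          + h ^ 2 • T := by
        ext i j
        simp only [A, hh, Matrix.add_apply, Matrix.smul_apply, smul_eq_mul]
        push_cast
        ring
      have eS : A k = (1 - ((k : ℝ) + 1) / (n + 1)) • S + ((k : ℝ) / (n + 1)) • T
          + h ^ 2 • S := by
        ext i j
        simp only [A, hh, Matrix.add_apply, Matrix.smul_apply, smul_eq_mul]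
        ring
      rw [eT, eS]
      exact hstep _ hB h (Real.sqrt_nonneg _)
    have hsum := Finset.sum_le_sum hA
    rw [Finset.sum_range_sub (fun k ↦ ∫ v, F v ∂(multivariateGaussian m (A k))),
      Finset.sum_const, Finset.card_range, nsmul_eq_mul] at hsum
    have hA0 : A 0 = S := by simp [A]
    have hA1 : A (n + 1) = T := by simp [A, div_self hn.ne']
    rw [hA0, hA1] at hsum
    refine le_trans (le_of_eq ?_) hsum
    have : ((n + 1 : ℕ) : ℝ) * h ^ 2 = 1 := by rw [hh]; push_cast; field_simp
    linear_combination (M * h) * this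
  have hlim : Filter.Tendsto (fun n : ℕ ↦ -M * √(1 / ((n : ℝ) + 1))) Filter.atTop (nhds 0) := by
    have := (Real.continuous_sqrt.tendsto 0).comp
      (tendsto_one_div_add_atTop_nhds_zero_nat (𝕜 := ℝ))
    simpa using this.const_mul (-M)
  exact sub_nonneg.1 (le_of_tendsto' hlim hbound)

end Gaussian
section Slepian

variable {ι : Type*} [Fintype ι]

lemma tendsto_smoothTransition_mul_sub (x y : ℝ) :
    Filter.Tendsto (fun n : ℕ ↦ smoothTransition (((n : ℝ) + 1) * (x - y))) Filter.atTop
      (nhds (if y < x then 1 else 0)) := by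
  split_ifs with h
  · refine tendsto_const_nhds.congr' ?_
    obtain ⟨N, hN⟩ := exists_nat_ge (1 / (x - y))
    filter_upwards [Filter.eventually_ge_atTop N] with n hn
    refine (smoothTransition.one_of_one_le ?_).symm
    have hn' : (N : ℝ) ≤ n := by exact_mod_cast hn
    have : 1 / (x - y) ≤ (n : ℝ) + 1 := by linarith
    rwa [div_le_iff₀ (sub_pos.2 h)] at this
  · refine tendsto_const_nhds.congr fun n ↦ (smoothTransition.zero_of_nonpos ?_).symm
    exact mul_nonpos_of_nonneg_of_nonpos (by positivity) (by linarith)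

lemma tendsto_integral_prod_smoothTransition (ν : Measure (EuclideanSpace ℝ ι))
    [IsProbabilityMeasure ν] (x : ℝ) :
    Filter.Tendsto (fun n : ℕ ↦ ∫ v, ∏ i, smoothTransition (((n : ℝ) + 1) * (x - v i)) ∂ν)
      Filter.atTop (nhds (ν.real {v | ∀ i, v i < x})) := by
  have hmeas : MeasurableSet {v : EuclideanSpace ℝ ι | ∀ i, v i < x} := by
    rw [Set.ofPred_forall]
    exact MeasurableSet.iInter fun i ↦ measurableSet_lt (by fun_prop) (by fun_prop)
  rw [← integral_indicator_one hmeas]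
  refine tendsto_integral_of_dominated_convergence (fun _ ↦ 1) (fun n ↦ ?_) (integrable_const _)
    (fun n ↦ ae_of_all _ fun v ↦ ?_) (ae_of_all _ fun v ↦ ?_)
  · refine Continuous.aestronglyMeasurable ?_
    exact continuous_finsetProd _ fun i _ ↦ smoothTransition.continuous.comp (by fun_prop)
  · rw [Real.norm_of_nonneg (Finset.prod_nonneg fun i _ ↦ smoothTransition.nonneg _)]
    exact Finset.prod_le_one (fun i _ ↦ smoothTransition.nonneg _)
      fun i _ ↦ smoothTransition.le_one _
  · have := tendsto_finsetProd Finset.univ fun i _ ↦ tendsto_smoothTransition_mul_sub x (v i)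
    convert this using 2
    rw [Finset.prod_ite_zero]
    simp [Set.indicator_apply]

variable [DecidableEq ι]

lemma integral_prod_smoothTransition_mono (m : EuclideanSpace ℝ ι) {S T : Matrix ι ι ℝ}
    (hS : S.PosSemidef) (hT : T.PosSemidef)
    (hdiag : ∀ i, S i i = T i i) (hle : ∀ i j, S i j ≤ T i j) {a : ℝ} (ha : 0 < a) (x : ℝ) :
    ∫ v, ∏ i, smoothTransition (a * (x - v i)) ∂(multivariateGaussian m S)
      ≤ ∫ v, ∏ i, smoothTransition (a * (x - v i)) ∂(multivariateGaussian m T) := by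
  have hg (n : ℕ) : ContDiff ℝ n (fun y ↦ smoothTransition (a * (x - y))) :=
    (smoothTransition.contDiff (n := (n : ℕ∞))).comp (by fun_prop)
  have hanti : Antitone (fun y ↦ smoothTransition (a * (x - y))) := fun y z hyz ↦
    smoothTransition.monotone (by gcongr)
  obtain ⟨C, hC⟩ := exists_norm_iteratedFDeriv_prod_coord_le (ι := ι) (hg 3)
    (exists_norm_iteratedFDeriv_smoothTransition_le ha x)
  refine integral_multivariateGaussian_mono m hS hT hdiag hle (contDiff_prod_coord (hg 3))
    (K := 1) (fun v ↦ ?_) hC fun w i j hij ↦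
      fderiv_fderiv_prod_coord_nonneg (hg 2) hanti (fun y ↦ smoothTransition.nonneg _) w hij
  rw [Real.norm_of_nonneg (Finset.prod_nonneg fun i _ ↦ smoothTransition.nonneg _)]
  exact Finset.prod_le_one (fun i _ ↦ smoothTransition.nonneg _)
    fun i _ ↦ smoothTransition.le_one _

/-- **Slepian's inequality** for multivariate Gaussian measures. -/
lemma multivariateGaussian_real_forall_lt_mono (m : EuclideanSpace ℝ ι) {S T : Matrix ι ι ℝ}
    (hS : S.PosSemidef) (hT : T.PosSemidef)
    (hdiag : ∀ i, S i i = T i i) (hle : ∀ i j, S i j ≤ T i j) (x : ℝ) :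
    (multivariateGaussian m S).real {v | ∀ i, v i < x}
      ≤ (multivariateGaussian m T).real {v | ∀ i, v i < x} :=
  le_of_tendsto_of_tendsto' (tendsto_integral_prod_smoothTransition _ x)
    (tendsto_integral_prod_smoothTransition _ x) fun _ ↦
      integral_prod_smoothTransition_mono m hS hT hdiag hle (by positivity) x

lemma map_toLp_eq_multivariateGaussian {Ω : Type*} [MeasurableSpace Ω] {P : Measure Ω}
    [IsProbabilityMeasure P] {m : ι → ℝ} {S : Matrix ι ι ℝ} (hS : S.PosSemidef)
    {X : ι → Ω → ℝ} (hX : ∀ i, Measurable (X i))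
    (hlaw : ∀ c : ι → ℝ, P.map (fun ω ↦ ∑ i, c i * X i ω)
      = gaussianReal (∑ i, c i * m i) (Real.toNNReal (∑ i, ∑ j, c i * c j * S i j))) :
    P.map (fun ω ↦ WithLp.toLp 2 fun i ↦ X i ω) = multivariateGaussian (WithLp.toLp 2 m) S := by
  have hmeas : Measurable fun ω ↦ WithLp.toLp 2 fun i ↦ X i ω := by fun_prop
  have := Measure.isProbabilityMeasure_map (μ := P) hmeas.aemeasurable
  refine Measure.ext_of_charFun (funext fun t ↦ ?_)
  have hquad : t.ofLp ⬝ᵥ S.mulVec t.ofLp = ∑ i, ∑ j, t i * t j * S i j := by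
    simp only [dotProduct, Matrix.mulVec, Finset.mul_sum]
    exact Finset.sum_congr rfl fun i _ ↦ Finset.sum_congr rfl fun j _ ↦ by ring
  have hnonneg : 0 ≤ ∑ i, ∑ j, t i * t j * S i j := by
    rw [← hquad]
    simpa using hS.dotProduct_mulVec_nonneg t.ofLp
  have hchar : charFun (P.map fun ω ↦ WithLp.toLp 2 fun i ↦ X i ω) t
      = charFun (P.map fun ω ↦ ∑ i, t i * X i ω) 1 := by
    rw [charFun_apply, charFun_apply_real, integral_map hmeas.aemeasurable (by fun_prop),
      integral_map (by fun_prop) (by fun_prop)]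
    simp [PiLp.inner_apply]
  rw [hchar, hlaw, charFun_gaussianReal, charFun_multivariateGaussian hS, hquad,
    Real.coe_toNNReal _ hnonneg]
  simp [PiLp.inner_apply, mul_comm]

lemma real_forall_lt_eq_multivariateGaussian {Ω : Type*} [MeasurableSpace Ω] {P : Measure Ω}
    [IsProbabilityMeasure P] {m : ι → ℝ} {S : Matrix ι ι ℝ} (hS : S.PosSemidef)
    {X : ι → Ω → ℝ} (hX : ∀ i, Measurable (X i))
    (hlaw : ∀ c : ι → ℝ, P.map (fun ω ↦ ∑ i, c i * X i ω)
      = gaussianReal (∑ i, c i * m i) (Real.toNNReal (∑ i, ∑ j, c i * c j * S i j))) (x : ℝ) :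
    P.real {ω | ∀ i, X i ω < x}
      = (multivariateGaussian (WithLp.toLp 2 m) S).real {v | ∀ i, v i < x} := by
  rw [← map_toLp_eq_multivariateGaussian hS hX hlaw, map_measureReal_apply (by fun_prop)]
  · rfl
  · rw [Set.ofPred_forall]
    exact MeasurableSet.iInter fun i ↦ measurableSet_lt (by fun_prop) (by fun_prop)

end Slepian

/-- Slepian's lemma, finite-dimensional form: Let `N ≥ 1`, `μ ∈ ℝ^N`, and
let `Σ_X, Σ_Y` be `N×N` positive semidefinite matrices with equal diagonals and
`Σ_X i j ≤ Σ_Y i j` for all `i,j`. Let `X` (resp. `Y`) be a Gaussian random vector with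
mean `μ` and covariance `Σ_X` (resp. `Σ_Y`), encoded by: every linear combination
`∑ c_i X_i` is Gaussian with mean `∑ c_i μ_i` and variance `∑_{i,j} c_i c_j Σ i j`.
Then for every `x`, `P(max_i X_i < x) ≤ P(max_i Y_i < x)`. -/
theorem stmt1 {Ω : Type*} [MeasurableSpace Ω] (P : Measure Ω) [IsProbabilityMeasure P]
    (N : ℕ) (hN : 1 ≤ N) (μ : Fin N → ℝ) (SX SY : Matrix (Fin N) (Fin N) ℝ)
    (hSX : SX.PosSemidef) (hSY : SY.PosSemidef)
    (hdiag : ∀ i, SX i i = SY i i) (hle : ∀ i j, SX i j ≤ SY i j)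
    (X Y : Fin N → Ω → ℝ) (hXm : ∀ i, Measurable (X i)) (hYm : ∀ i, Measurable (Y i))
    (hXg : ∀ c : Fin N → ℝ,
      Measure.map (fun ω => ∑ i, c i * X i ω) P
        = gaussianReal (∑ i, c i * μ i) (Real.toNNReal (∑ i, ∑ j, c i * c j * SX i j)))
    (hYg : ∀ c : Fin N → ℝ,
      Measure.map (fun ω => ∑ i, c i * Y i ω) P
        = gaussianReal (∑ i, c i * μ i) (Real.toNNReal (∑ i, ∑ j, c i * c j * SY i j)))
    (x : ℝ) :
    (P {ω | ∀ i, X i ω < x}).toReal ≤ (P {ω | ∀ i, Y i ω < x}).toReal := by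
  rw [← measureReal_def, ← measureReal_def, real_forall_lt_eq_multivariateGaussian hSX hXm hXg,
    real_forall_lt_eq_multivariateGaussian hSY hYm hYg]
  exact multivariateGaussian_real_forall_lt_mono _ hSX hSY hdiag hle x
end

section
/- (Gaussian comparison inequality; Lemma A4 of Bickel–Rosenblatt.) Let N ≥ 1 and let Σ₁ = (r_{ij}) and Σ₂ = (s_{ij}) be N×N positive semidefinite matrices with r_{ii} = s_{ii} = 1 for all i and |r_{ij}| < 1, |s_{ij}| < 1 for all i ≠ j. Let P_{Σ₁} and P_{Σ₂} denote the laws of a centered Gaussian vector X = (X_1,…,X_N) with covariance matrix Σ₁ and Σ₂ respectively. Let u_1,…,u_N be nonnegative reals and u = min_j u_j. Then |P_{Σ₁}(X_j ≤ u_j for all 1 ≤ j ≤ N) − P_{Σ₂}(X_j ≤ u_j for all 1 ≤ j ≤ N)| ≤ 4 ∑_{i≠j} |∫_{s_{ij}}^{r_{ij}} φ₂(u,u,λ) dλ|, where φ₂(x,y,ρ) = (2π(1−ρ²)^{1/2})^{-1} exp(−(x² − 2ρxy + y²)/(2(1−ρ²))) is the standard bivariate normal density with correlation ρ. -/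
open MeasureTheory ProbabilityTheory Real
open scoped NNReal

/-- The standard bivariate normal density with correlation `ρ`, evaluated at `(x,y)`:
`φ₂(x,y,ρ) = (2π(1−ρ²)^{1/2})^{-1} exp(−(x² − 2ρxy + y²)/(2(1−ρ²)))`. -/
noncomputable def biNormalPDF (x y ρ : ℝ) : ℝ :=
  (2 * Real.pi * Real.sqrt (1 - ρ ^ 2))⁻¹ *
    Real.exp (-(x ^ 2 - 2 * ρ * x * y + y ^ 2) / (2 * (1 - ρ ^ 2)))

open scoped FourierTransform SchwartzMap

/-- The quadratic form `c ↦ cᵀ S c`. -/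
noncomputable def quadForm {N : ℕ} (S : Matrix (Fin N) (Fin N) ℝ) (c : Fin N → ℝ) : ℝ :=
  ∑ i, ∑ j, c i * c j * S i j

/-- `P` is the law of a centered Gaussian vector with covariance matrix `S`, expressed through
the laws of linear combinations of the coordinates. -/
def IsCenteredGaussian {N : ℕ} (S : Matrix (Fin N) (Fin N) ℝ) (P : Measure (Fin N → ℝ)) : Prop :=
  ∀ c : Fin N → ℝ, 0 ≤ quadForm S c ∧
    Measure.map (fun y => ∑ i, c i * y i) P = gaussianReal 0 (Real.toNNReal (quadForm S c))

lemma quadForm_nonneg {N : ℕ} {S : Matrix (Fin N) (Fin N) ℝ} (hS : S.PosSemidef)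
    (c : Fin N → ℝ) : 0 ≤ quadForm S c := by
  have h := hS.dotProduct_mulVec_nonneg c
  simp only [dotProduct, Matrix.mulVec, Finset.mul_sum, Pi.star_apply, star_trivial] at h
  refine h.trans_eq (Finset.sum_congr rfl fun i _ => Finset.sum_congr rfl fun j _ => by ring)

lemma quadForm_add_smul {N : ℕ} (S T : Matrix (Fin N) (Fin N) ℝ) (a b : ℝ) (c : Fin N → ℝ) :
    quadForm (a • S + b • T) c = a * quadForm S c + b * quadForm T c := by
  simp only [quadForm, Finset.mul_sum, ← Finset.sum_add_distrib, Matrix.add_apply,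
    Matrix.smul_apply, smul_eq_mul]
  refine Finset.sum_congr rfl fun i _ => Finset.sum_congr rfl fun j _ => by ring

@[fun_prop]
lemma continuous_quadForm {N : ℕ} (S : Matrix (Fin N) (Fin N) ℝ) : Continuous (quadForm S) := by
  unfold quadForm; fun_prop

namespace IsCenteredGaussian

variable {N : ℕ} {S T : Matrix (Fin N) (Fin N) ℝ} {P Q : Measure (Fin N → ℝ)}

lemma integral_cexp (h : IsCenteredGaussian S P) (c : Fin N → ℝ) :
    ∫ x, Complex.exp (((∑ i, c i * x i : ℝ) : ℂ) * Complex.I) ∂P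
      = Complex.exp (-(quadForm S c : ℂ) / 2) := by
  have h1 := charFun_gaussianReal (μ := 0) (v := Real.toNNReal (quadForm S c)) 1
  rw [← (h c).2, charFun_apply_real, integral_map (Measurable.aemeasurable (by fun_prop))
    (by fun_prop)] at h1
  simp only [Real.coe_toNNReal _ (h c).1] at h1
  rw [← sub_eq_zero] at h1 ⊢
  rw [← h1]
  congr 2
  · simp
  · push_cast; ring

/-- Convex combinations of covariance matrices are realised by `√t X + √(1 - t) Y` with `X`, `Y`
independent. -/
lemma exists_convex_combination [IsProbabilityMeasure P] [IsProbabilityMeasure Q]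
    (hP : IsCenteredGaussian S P) (hQ : IsCenteredGaussian T Q) {t : ℝ}
    (ht : t ∈ Set.Icc (0 : ℝ) 1) :
    ∃ R : Measure (Fin N → ℝ), IsProbabilityMeasure R ∧
      IsCenteredGaussian (t • S + (1 - t) • T) R := by
  have ht1 : 0 ≤ 1 - t := by linarith [ht.2]
  let Z : (Fin N → ℝ) × (Fin N → ℝ) → Fin N → ℝ := fun p i => √t * p.1 i + √(1 - t) * p.2 i
  have hZ : Measurable Z := by fun_prop
  refine ⟨(P.prod Q).map Z, Measure.isProbabilityMeasure_map hZ.aemeasurable, fun c => ?_⟩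
  have hS := (hP c).1
  have hT := (hQ c).1
  have hscale : ∀ (R : Measure (Fin N → ℝ)) (U : Matrix (Fin N) (Fin N) ℝ) (s : ℝ), 0 ≤ s →
      IsCenteredGaussian U R → R.map (fun x => √s * ∑ i, c i * x i)
        = gaussianReal 0 (Real.toNNReal (s * quadForm U c)) := by
    intro R U s hs hR
    have h := gaussianReal_map_const_mul (μ := 0) (v := Real.toNNReal (quadForm U c)) √s
    rw [← (hR c).2, Measure.map_map (by fun_prop) (by fun_prop)] at h
    refine h.trans ?_
    congr 1
    · simp
    · ext
      simp [Real.sq_sqrt hs, Real.coe_toNNReal _ (hR c).1,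
        Real.coe_toNNReal _ (mul_nonneg hs (hR c).1)]
  refine ⟨by rw [quadForm_add_smul]; have := ht.1; positivity, ?_⟩
  rw [Measure.map_map (by fun_prop) hZ]
  have hind := indepFun_prod (μ := P) (ν := Q) (X := fun x => √t * ∑ i, c i * x i)
    (Y := fun x => √(1 - t) * ∑ i, c i * x i) (by fun_prop) (by fun_prop)
  have h := gaussianReal_add_gaussianReal_of_indepFun (m₁ := 0) (m₂ := 0)
    (v₁ := Real.toNNReal (t * quadForm S c)) (v₂ := Real.toNNReal ((1 - t) * quadForm T c)) hind
    ?_ ?_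
  · convert h using 2
    · ext p
      simp only [Function.comp_apply, Pi.add_apply, Finset.mul_sum, ← Finset.sum_add_distrib, Z]
      exact Finset.sum_congr rfl fun i _ => by ring
    · simp
    · rw [quadForm_add_smul, Real.toNNReal_add (mul_nonneg ht.1 hS) (mul_nonneg ht1 hT)]
  · rw [← hscale P S t ht.1 hP]
    have := measurePreserving_fst (μ := P) (ν := Q)
    conv_rhs => rw [← this.map_eq]
    rw [Measure.map_map (by fun_prop) (by fun_prop)]
    rfl
  · rw [← hscale Q T _ ht1 hQ]
    have := measurePreserving_snd (μ := P) (ν := Q)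
    conv_rhs => rw [← this.map_eq]
    rw [Measure.map_map (by fun_prop) (by fun_prop)]
    rfl

/-- Fourier representation of the Gaussian expectation of a product of Schwartz functions. -/
lemma integral_prod_schwartz [IsProbabilityMeasure P] (h : IsCenteredGaussian S P)
    (f : Fin N → 𝓢(ℝ, ℂ)) :
    ∫ x, ∏ k, f k (x k) ∂P
      = ∫ c : Fin N → ℝ, (∏ k, 𝓕 (f k) (c k)) *
          Complex.exp (((-2 * π ^ 2 * quadForm S c : ℝ) : ℂ)) := by
  have hinv : ∀ (x : Fin N → ℝ), ∏ k, f k (x k) = ∫ c : Fin N → ℝ, (∏ k, 𝓕 (f k) (c k)) *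
      Complex.exp (((∑ k, (2 * π * c k) * x k : ℝ) : ℂ) * Complex.I) := by
    intro x
    have h1 : ∀ k, f k (x k) = ∫ v : ℝ, 𝓕 (f k) v *
        Complex.exp (((2 * π * v * x k : ℝ) : ℂ) * Complex.I) := by
      intro k
      conv_lhs => rw [← FourierTransform.fourierInv_fourier_eq (F := 𝓢(ℝ, ℂ)) (f k),
        SchwartzMap.fourierInv_coe,
        Real.fourierInv_eq']
      refine integral_congr_ae (.of_forall fun v => ?_)
      simp only [smul_eq_mul, RCLike.inner_apply, conj_trivial]
      rw [mul_comm]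
      congr 4
      ring
    simp_rw [h1]
    rw [← integral_fintype_prod_volume_eq_prod]
    refine integral_congr_ae (.of_forall fun c => ?_)
    simp only [Finset.prod_mul_distrib, ← Complex.exp_sum, ← Finset.sum_mul]
    push_cast
    rfl
  simp_rw [hinv]
  rw [integral_integral_swap]
  · refine integral_congr_ae (.of_forall fun c => ?_)
    simp only
    rw [integral_const_mul, h.integral_cexp fun k => 2 * π * c k]
    congr 2
    have : quadForm S (fun k => 2 * π * c k) = 4 * π ^ 2 * quadForm S c := by
      simp only [quadForm, Finset.mul_sum]
      refine Finset.sum_congr rfl fun i _ => Finset.sum_congr rfl fun j _ => by ring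
    rw [this]
    push_cast
    ring
  · have hi : Integrable (fun c : Fin N → ℝ => ∏ k, 𝓕 (f k) (c k)) :=
      Integrable.fintype_prod fun k => (𝓕 (f k)).integrable
    have hi2 : Integrable (fun p : (Fin N → ℝ) × (Fin N → ℝ) => ∏ k, 𝓕 (f k) (p.2 k))
        (P.prod volume) := hi.comp_snd P
    refine hi2.mul_bdd (c := 1) (Continuous.aestronglyMeasurable (by fun_prop))
      (.of_forall fun p => ?_)
    rw [Complex.norm_exp_ofReal_mul_I]

end IsCenteredGaussian

section Interpolation

variable {N : ℕ}

/-- The family `f` with its `i`-th and `j`-th members differentiated. -/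
noncomputable def derivPair (f : Fin N → 𝓢(ℝ, ℂ)) (i j : Fin N) : Fin N → 𝓢(ℝ, ℂ) :=
  fun k => if k = i ∨ k = j then SchwartzMap.derivCLM ℂ ℂ (f k) else f k

lemma fourier_derivCLM_apply (f : 𝓢(ℝ, ℂ)) (c : ℝ) :
    𝓕 (SchwartzMap.derivCLM ℂ ℂ f) c = (2 * π * Complex.I * c) * 𝓕 f c := by
  have h := Real.fourier_deriv f.integrable f.differentiable
    (SchwartzMap.derivCLM ℂ ℂ f).integrable
  rw [SchwartzMap.fourier_coe, SchwartzMap.fourier_coe]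
  exact congrFun h c

lemma prod_fourier_derivPair (f : Fin N → 𝓢(ℝ, ℂ)) {i j : Fin N} (hij : i ≠ j)
    (c : Fin N → ℝ) :
    ∏ k, 𝓕 (derivPair f i j k) (c k) = (-4 * π ^ 2 * (c i * c j)) * ∏ k, 𝓕 (f k) (c k) := by
  have h : ∀ k, 𝓕 (derivPair f i j k) (c k) = (if k = i then 2 * π * Complex.I * c k else 1) *
      (if k = j then 2 * π * Complex.I * c k else 1) * 𝓕 (f k) (c k) := by
    intro k
    by_cases hi : k = i
    · have : k ≠ j := hi ▸ hij
      simp only [derivPair, hi, true_or, if_true, fourier_derivCLM_apply, hij, if_false, mul_one]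
    · by_cases hj : k = j
      · simp only [derivPair, hj, or_true, if_true, fourier_derivCLM_apply, hij.symm, if_false,
          one_mul]
      · simp [derivPair, hi, hj]
  simp_rw [h, Finset.prod_mul_distrib, Finset.prod_ite_eq', Finset.mem_univ, if_true]
  congr 1
  linear_combination (4 * π ^ 2 * (c i * c j) : ℂ) * Complex.I_sq

lemma prod_fourier_mul_quadForm (f : Fin N → 𝓢(ℝ, ℂ)) (D : Matrix (Fin N) (Fin N) ℝ)
    (hD : ∀ i, D i i = 0) (c : Fin N → ℝ) :
    (∏ k, 𝓕 (f k) (c k)) * ((-2 * π ^ 2 * quadForm D c : ℝ) : ℂ)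
      = ∑ i, ∑ j, (D i j / 2 : ℂ) * ∏ k, 𝓕 (derivPair f i j k) (c k) := by
  have h : ∀ i j, (D i j / 2 : ℂ) * ∏ k, 𝓕 (derivPair f i j k) (c k)
      = (∏ k, 𝓕 (f k) (c k)) * ((-2 * π ^ 2 * (c i * c j * D i j) : ℝ) : ℂ) := by
    intro i j
    by_cases hij : i = j
    · simp [hij, hD]
    · rw [prod_fourier_derivPair f hij]
      push_cast
      ring
  simp_rw [h, ← Finset.mul_sum, ← Complex.ofReal_sum, ← Finset.mul_sum]
  rfl

lemma integrable_prod_fourier (f : Fin N → 𝓢(ℝ, ℂ)) :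
    Integrable (fun c : Fin N → ℝ => ∏ k, 𝓕 (f k) (c k)) :=
  Integrable.fintype_prod fun k => (𝓕 (f k)).integrable

lemma norm_cexp_quadForm_le {S : Matrix (Fin N) (Fin N) ℝ} {c : Fin N → ℝ}
    (h : 0 ≤ quadForm S c) : ‖Complex.exp ((-2 * π ^ 2 * quadForm S c : ℝ) : ℂ)‖ ≤ 1 := by
  rw [Complex.norm_exp_ofReal, Real.exp_le_one_iff]
  have := mul_nonneg (sq_nonneg π) h
  linarith

/-- The expectation of `∏ k, f k (X k)` under the centered Gaussian law with covariance
`t S + (1 - t) T`, on the Fourier side. -/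
noncomputable def interpolant (f : Fin N → 𝓢(ℝ, ℂ)) (S T : Matrix (Fin N) (Fin N) ℝ) (t : ℝ) : ℂ :=
  ∫ c : Fin N → ℝ, (∏ k, 𝓕 (f k) (c k)) *
    Complex.exp ((-2 * π ^ 2 * quadForm (t • S + (1 - t) • T) c : ℝ) : ℂ)

variable {S T : Matrix (Fin N) (Fin N) ℝ}

lemma quadForm_interpolation_nonneg (hS : ∀ c, 0 ≤ quadForm S c) (hT : ∀ c, 0 ≤ quadForm T c)
    {t : ℝ} (ht : t ∈ Set.Icc (0 : ℝ) 1) (c : Fin N → ℝ) :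
    0 ≤ quadForm (t • S + (1 - t) • T) c := by
  rw [quadForm_add_smul]
  exact add_nonneg (mul_nonneg ht.1 (hS c)) (mul_nonneg (by linarith [ht.2]) (hT c))

lemma continuousOn_interpolant (f : Fin N → 𝓢(ℝ, ℂ)) (hS : ∀ c, 0 ≤ quadForm S c)
    (hT : ∀ c, 0 ≤ quadForm T c) : ContinuousOn (interpolant f S T) (Set.Icc 0 1) := by
  refine continuousOn_of_dominated (F := fun t c => (∏ k, 𝓕 (f k) (c k)) *
      Complex.exp ((-2 * π ^ 2 * quadForm (t • S + (1 - t) • T) c : ℝ) : ℂ))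
    (bound := fun c => ‖∏ k, 𝓕 (f k) (c k)‖)
    (fun t _ => Continuous.aestronglyMeasurable (by fun_prop)) (fun t ht => .of_forall fun c => ?_)
    (integrable_prod_fourier f).norm (.of_forall fun c => ?_)
  · rw [norm_mul]
    exact mul_le_of_le_one_right (norm_nonneg _)
      (norm_cexp_quadForm_le (quadForm_interpolation_nonneg hS hT ht c))
  · have hq : Continuous fun t : ℝ => quadForm (t • S + (1 - t) • T) c := by
      simp only [quadForm_add_smul]
      fun_prop
    exact (continuous_const.mul (Complex.continuous_exp.comp
      (Complex.continuous_ofReal.comp (continuous_const.mul hq)))).continuousOn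

lemma hasDerivAt_interpolant (f : Fin N → 𝓢(ℝ, ℂ)) (hS : ∀ c, 0 ≤ quadForm S c)
    (hT : ∀ c, 0 ≤ quadForm T c) (hd : ∀ i, S i i = T i i) {t : ℝ} (ht : t ∈ Set.Ioo (0 : ℝ) 1) :
    HasDerivAt (interpolant f S T)
      (∑ i, ∑ j, ((S - T) i j / 2 : ℂ) * interpolant (derivPair f i j) S T t) t := by
  have hD : ∀ i, (S - T) i i = 0 := fun i => by simp [hd]
  have hprod := prod_fourier_mul_quadForm f (S - T) hD
  have hi : ∀ i j, Integrable fun c : Fin N → ℝ =>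
      ((S - T) i j / 2 : ℂ) * ∏ k, 𝓕 (derivPair f i j k) (c k) :=
    fun i j => (integrable_prod_fourier _).const_mul _
  have hbint : Integrable fun c : Fin N → ℝ =>
      ‖(∏ k, 𝓕 (f k) (c k)) * ((-2 * π ^ 2 * quadForm (S - T) c : ℝ) : ℂ)‖ := by
    simp_rw [hprod]
    exact (integrable_finsetSum _ fun i _ => integrable_finsetSum _ fun j _ => hi i j).norm
  have hexp : ∀ (g : (Fin N → ℝ) → ℂ), Integrable g → Integrable fun c =>
      g c * Complex.exp ((-2 * π ^ 2 * quadForm (t • S + (1 - t) • T) c : ℝ) : ℂ) := fun g hg =>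
    hg.mul_bdd (c := 1) (Continuous.aestronglyMeasurable (by fun_prop)) (.of_forall fun c =>
      norm_cexp_quadForm_le (quadForm_interpolation_nonneg hS hT (Set.Ioo_subset_Icc_self ht) c))
  have key := (hasDerivAt_integral_of_dominated_loc_of_deriv_le
    (F := fun t c => (∏ k, 𝓕 (f k) (c k)) *
      Complex.exp ((-2 * π ^ 2 * quadForm (t • S + (1 - t) • T) c : ℝ) : ℂ))
    (F' := fun t c => ((∏ k, 𝓕 (f k) (c k)) * ((-2 * π ^ 2 * quadForm (S - T) c : ℝ) : ℂ)) *
      Complex.exp ((-2 * π ^ 2 * quadForm (t • S + (1 - t) • T) c : ℝ) : ℂ))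
    (Ioo_mem_nhds ht.1 ht.2) (.of_forall fun t => Continuous.aestronglyMeasurable (by fun_prop))
    (hexp _ (integrable_prod_fourier f)) (Continuous.aestronglyMeasurable (by fun_prop))
    (.of_forall fun c s hs => ?_) hbint (.of_forall fun c s _ => ?_)).2
  · refine HasDerivAt.congr_deriv key ?_
    simp only [hprod, Finset.sum_mul]
    rw [integral_finsetSum _ fun i _ => integrable_finsetSum _ fun j _ => hexp _ (hi i j)]
    refine Finset.sum_congr rfl fun i _ => ?_
    rw [integral_finsetSum _ fun j _ => hexp _ (hi i j)]
    refine Finset.sum_congr rfl fun j _ => ?_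
    rw [interpolant, ← integral_const_mul]
    exact integral_congr_ae (.of_forall fun c => by ring)
  · rw [norm_mul]
    exact mul_le_of_le_one_right (norm_nonneg _) (norm_cexp_quadForm_le
      (quadForm_interpolation_nonneg hS hT (Set.Ioo_subset_Icc_self hs) c))
  · have hq : quadForm (S - T) c = quadForm S c - quadForm T c := by
      have := quadForm_add_smul S T 1 (-1) c
      simp only [one_smul, neg_smul, one_mul, ← sub_eq_add_neg] at this
      rw [this]; ring
    have h1 : HasDerivAt (fun s : ℝ => -2 * π ^ 2 * quadForm (s • S + (1 - s) • T) c)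
        (-2 * π ^ 2 * quadForm (S - T) c) s := by
      simp only [quadForm_add_smul, hq]
      have := (((hasDerivAt_id s).mul_const (quadForm S c)).add
        (((hasDerivAt_id s).const_sub 1).mul_const (quadForm T c))).const_mul (-2 * π ^ 2)
      exact this.congr_deriv (by ring)
    exact ((h1.ofReal_comp.cexp).const_mul (∏ k, 𝓕 (f k) (c k))).congr_deriv (by ring)

end Interpolation

section Bivariate

lemma biNormalPDF_le_of_le {u x y ρ : ℝ} (hu : 0 ≤ u) (hx : u ≤ x) (hy : u ≤ y)
    (hρ : |ρ| < 1) : biNormalPDF x y ρ ≤ biNormalPDF u u ρ := by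
  obtain ⟨h1, h2⟩ := abs_lt.1 hρ
  have hpos : 0 < 1 - ρ ^ 2 := by nlinarith
  unfold biNormalPDF
  refine mul_le_mul_of_nonneg_left (Real.exp_le_exp.2
    (div_le_div_of_nonneg_right ?_ (by positivity))) (by positivity)
  obtain ⟨a, rfl⟩ := exists_add_of_le hx
  obtain ⟨b, rfl⟩ := exists_add_of_le hy
  have ha : 0 ≤ a := by linarith
  have hb : 0 ≤ b := by linarith
  have h3 : 0 ≤ u * (1 - ρ) * (a + b) := by
    have : 0 ≤ 1 - ρ := by linarith
    positivity
  have h4 : 0 ≤ (1 - ρ) * (a * b) := by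
    have : 0 ≤ 1 - ρ := by linarith
    positivity
  nlinarith [sq_nonneg (a - b)]

lemma gaussianPDF_mul_gaussianPDF {ρ : ℝ} (hρ : |ρ| < 1) (x y : ℝ) :
    gaussianPDF 0 1 x * gaussianPDF (ρ * x) (Real.toNNReal (1 - ρ ^ 2)) y
      = ENNReal.ofReal (biNormalPDF x y ρ) := by
  obtain ⟨h1, h2⟩ := abs_lt.1 hρ
  have hpos : 0 < 1 - ρ ^ 2 := by nlinarith
  rw [gaussianPDF, gaussianPDF, ← ENNReal.ofReal_mul (gaussianPDFReal_nonneg _ _ _)]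
  congr 1
  simp only [gaussianPDFReal, biNormalPDF, Real.coe_toNNReal _ hpos.le, NNReal.coe_one]
  rw [mul_mul_mul_comm, ← Real.exp_add, ← mul_inv]
  congr 2
  · rw [Real.sqrt_mul (by positivity) (1 - ρ ^ 2), ← mul_assoc, mul_one,
      Real.mul_self_sqrt (by positivity)]
  · field_simp
    ring

lemma gaussianPDF_zero_one_le_one (x : ℝ) : gaussianPDF 0 1 x ≤ 1 := by
  rw [gaussianPDF, ENNReal.ofReal_le_one, gaussianPDFReal]
  refine mul_le_one₀ (inv_le_one_of_one_le₀ ?_) (Real.exp_nonneg _) ?_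
  · rw [Real.one_le_sqrt]
    have := Real.pi_gt_three
    simp only [NNReal.coe_one]
    linarith
  · rw [Real.exp_le_one_iff]
    exact div_nonpos_of_nonpos_of_nonneg (by nlinarith [sq_nonneg (x - 0)]) (by positivity)

namespace IsCenteredGaussian

variable {N : ℕ} {S : Matrix (Fin N) (Fin N) ℝ} {P : Measure (Fin N → ℝ)}

lemma map_eval (h : IsCenteredGaussian S P) {i : Fin N} (hi : S i i = 1) :
    P.map (fun x => x i) = gaussianReal 0 1 := by
  have := (h (Pi.single i 1)).2
  simpa [quadForm, Pi.single_apply, hi] using this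

lemma lintegral_le (h : IsCenteredGaussian S P) {i : Fin N} (hi : S i i = 1)
    {G : ℝ → ENNReal} (hG : Measurable G) : ∫⁻ x, G (x i) ∂P ≤ ∫⁻ y, G y := by
  rw [← lintegral_map (f := G) (g := fun x : Fin N → ℝ => x i) hG (by fun_prop), h.map_eval hi,
    gaussianReal_of_var_ne_zero _ one_ne_zero,
    lintegral_withDensity_eq_lintegral_mul _ (measurable_gaussianPDF _ _) hG]
  exact lintegral_mono fun y => mul_le_of_le_one_left' (gaussianPDF_zero_one_le_one y)

lemma map_pair [IsProbabilityMeasure P] (h : IsCenteredGaussian S P) {i j : Fin N} {ρ : ℝ}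
    (hi : S i i = 1) (hj : S j j = 1) (hSij : S i j = ρ) (hSji : S j i = ρ)
    (hρ : |ρ| < 1) :
    P.map (fun x => (x i, x j)) = ((gaussianReal 0 1).prod (gaussianReal 0 1)).map
      (fun p : ℝ × ℝ => (p.1, ρ * p.1 + √(1 - ρ ^ 2) * p.2)) := by
  obtain ⟨h1, h2⟩ := abs_lt.1 hρ
  have hpos : 0 < 1 - ρ ^ 2 := by nlinarith
  have hm : Measurable fun p : ℝ × ℝ => (p.1, ρ * p.1 + √(1 - ρ ^ 2) * p.2) := by fun_prop
  have hm' : Measurable fun x : Fin N → ℝ => (x i, x j) := by fun_prop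
  have := Measure.isProbabilityMeasure_map (μ := P) hm'.aemeasurable
  have := Measure.isProbabilityMeasure_map
    (μ := (gaussianReal 0 1).prod (gaussianReal 0 1)) hm.aemeasurable
  refine Measure.ext_of_charFunDual (funext fun L => ?_)
  have hL : ∀ x y : ℝ, L (x, y) = L (1, 0) * x + L (0, 1) * y := by
    intro x y
    have : (x, y) = x • ((1 : ℝ), (0 : ℝ)) + y • ((0 : ℝ), (1 : ℝ)) := by simp
    rw [this, map_add, map_smul, map_smul]
    simp only [smul_eq_mul]
    ring
  generalize L (1, 0) = a at hL
  generalize L (0, 1) = b at hL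
  rw [charFunDual_apply, charFunDual_apply, integral_map hm'.aemeasurable (by fun_prop),
    integral_map hm.aemeasurable (by fun_prop)]
  simp only [hL]
  have e1 := h.integral_cexp (Pi.single i a + Pi.single j b)
  have e2 : quadForm S (Pi.single i a + Pi.single j b) = a ^ 2 + 2 * ρ * a * b + b ^ 2 := by
    simp only [quadForm, Pi.add_apply, add_mul, mul_add, Finset.sum_add_distrib, Pi.single_apply,
      ite_mul, mul_ite, zero_mul, mul_zero, Finset.sum_ite_eq', Finset.mem_univ, if_true, hi, hj,
      hSij, hSji]
    ring
  simp only [e2, Pi.add_apply, add_mul, Finset.sum_add_distrib, Pi.single_apply, ite_mul, zero_mul,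
    Finset.sum_ite_eq', Finset.mem_univ, if_true] at e1
  rw [e1]
  have hchar : ∀ s : ℝ, ∫ x, Complex.exp (s * x * Complex.I) ∂gaussianReal 0 1
      = Complex.exp (-(s ^ 2 / 2 : ℝ)) := by
    intro s
    rw [← charFun_apply_real, charFun_gaussianReal]
    congr 1
    push_cast
    ring
  have hsplit : ∀ p : ℝ × ℝ, Complex.exp
      (((a * p.1 + b * (ρ * p.1 + √(1 - ρ ^ 2) * p.2) : ℝ) : ℂ) * Complex.I)
      = Complex.exp (((a + b * ρ : ℝ) : ℂ) * p.1 * Complex.I) *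
        Complex.exp (((b * √(1 - ρ ^ 2) : ℝ) : ℂ) * p.2 * Complex.I) := by
    intro p
    rw [← Complex.exp_add]
    congr 1
    push_cast
    ring
  simp_rw [hsplit]
  rw [integral_prod_mul (fun x : ℝ => Complex.exp (((a + b * ρ : ℝ) : ℂ) * x * Complex.I))
    (fun y : ℝ => Complex.exp (((b * √(1 - ρ ^ 2) : ℝ) : ℂ) * y * Complex.I)), hchar, hchar,
    ← Complex.exp_add, mul_pow, Real.sq_sqrt hpos.le]
  congr 1
  push_cast
  ring

lemma lintegral_pair_le [IsProbabilityMeasure P] (h : IsCenteredGaussian S P) {i j : Fin N}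
    {ρ u : ℝ} (hi : S i i = 1) (hj : S j j = 1) (hSij : S i j = ρ)
    (hSji : S j i = ρ) (hρ : |ρ| < 1) (hu : 0 ≤ u) {G H : ℝ → ENNReal} (hG : Measurable G)
    (hH : Measurable H) (hGu : ∀ x < u, G x = 0) (hHu : ∀ x < u, H x = 0) :
    ∫⁻ x, G (x i) * H (x j) ∂P
      ≤ ENNReal.ofReal (biNormalPDF u u ρ) * ((∫⁻ x, G x) * ∫⁻ x, H x) := by
  obtain ⟨h1, h2⟩ := abs_lt.1 hρ
  have hpos : 0 < 1 - ρ ^ 2 := by nlinarith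
  have hm : Measurable fun p : ℝ × ℝ => (p.1, ρ * p.1 + √(1 - ρ ^ 2) * p.2) := by fun_prop
  have hm' : Measurable fun x : Fin N → ℝ => (x i, x j) := by fun_prop
  have hGH : Measurable fun p : ℝ × ℝ => G p.1 * H p.2 := by fun_prop
  have hGH' : Measurable fun p : ℝ × ℝ => G p.1 * H (ρ * p.1 + √(1 - ρ ^ 2) * p.2) := hGH.comp hm
  have hcond : ∀ x : ℝ, (gaussianReal 0 1).map (fun y => ρ * x + √(1 - ρ ^ 2) * y)
      = gaussianReal (ρ * x) (Real.toNNReal (1 - ρ ^ 2)) := by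
    intro x
    have := gaussianReal_map_const_add (μ := √(1 - ρ ^ 2) * 0)
      (v := NNReal.mk (√(1 - ρ ^ 2) ^ 2) (sq_nonneg _) * 1) (ρ * x)
    rw [← gaussianReal_map_const_mul, Measure.map_map (by fun_prop) (by fun_prop)] at this
    refine this.trans ?_
    congr 1
    · simp
    · ext
      simp [Real.sq_sqrt hpos.le, hpos.le]
  have hinner : ∀ x : ℝ, ∫⁻ y, H (ρ * x + √(1 - ρ ^ 2) * y) ∂gaussianReal 0 1
      = ∫⁻ y, gaussianPDF (ρ * x) (Real.toNNReal (1 - ρ ^ 2)) y * H y := by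
    intro x
    rw [← lintegral_map (f := H) (g := fun y => ρ * x + √(1 - ρ ^ 2) * y) hH (by fun_prop), hcond x,
      gaussianReal_of_var_ne_zero _ (by simpa using hpos),
      lintegral_withDensity_eq_lintegral_mul _ (measurable_gaussianPDF _ _) hH]
    rfl
  have hmeas : Measurable fun x => ∫⁻ y, H (ρ * x + √(1 - ρ ^ 2) * y) ∂gaussianReal 0 1 :=
    Measurable.lintegral_prod_right (hH.comp (by fun_prop :
      Measurable fun p : ℝ × ℝ => ρ * p.1 + √(1 - ρ ^ 2) * p.2))
  calc ∫⁻ x, G (x i) * H (x j) ∂P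
      = ∫⁻ p, G p.1 * H p.2 ∂(P.map fun x => (x i, x j)) :=
        (lintegral_map hGH hm').symm
    _ = ∫⁻ x, G x * ∫⁻ y, H (ρ * x + √(1 - ρ ^ 2) * y) ∂gaussianReal 0 1 ∂gaussianReal 0 1 := by
        rw [h.map_pair hi hj hSij hSji hρ, lintegral_map hGH hm,
          lintegral_prod _ hGH'.aemeasurable]
        refine lintegral_congr fun x => ?_
        have hHx : Measurable fun y => H (ρ * x + √(1 - ρ ^ 2) * y) := by fun_prop
        exact lintegral_const_mul (G x) hHx
    _ = ∫⁻ x, ∫⁻ y, ENNReal.ofReal (biNormalPDF x y ρ) * (G x * H y) := by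
        rw [gaussianReal_of_var_ne_zero (v := 1) _ one_ne_zero] at hmeas hinner ⊢
        simp only [hinner] at hmeas ⊢
        have hGmeas : Measurable fun x => G x *
            ∫⁻ y, gaussianPDF (ρ * x) (Real.toNNReal (1 - ρ ^ 2)) y * H y := hG.mul hmeas
        rw [lintegral_withDensity_eq_lintegral_mul _ (measurable_gaussianPDF _ _) hGmeas]
        refine lintegral_congr fun x => ?_
        have hpdf := measurable_gaussianPDF (ρ * x) (Real.toNNReal (1 - ρ ^ 2))
        have hpH : Measurable fun y =>
            gaussianPDF (ρ * x) (Real.toNNReal (1 - ρ ^ 2)) y * H y := hpdf.mul hH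
        rw [Pi.mul_apply, ← lintegral_const_mul _ hpH, ← lintegral_const_mul _ (hpH.const_mul _)]
        refine lintegral_congr fun y => ?_
        rw [← gaussianPDF_mul_gaussianPDF hρ]
        ring
    _ ≤ ∫⁻ x, ∫⁻ y, ENNReal.ofReal (biNormalPDF u u ρ) * (G x * H y) := by
        refine lintegral_mono fun x => lintegral_mono fun y => ?_
        rcases lt_or_ge x u with hx | hx
        · simp [hGu x hx]
        rcases lt_or_ge y u with hy | hy
        · simp [hHu y hy]
        simp only
        gcongr
        exact biNormalPDF_le_of_le hu hx hy hρ
    _ = _ := by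
        have : ∀ x, ∫⁻ y, ENNReal.ofReal (biNormalPDF u u ρ) * (G x * H y)
            = ENNReal.ofReal (biNormalPDF u u ρ) * (G x * ∫⁻ y, H y) := fun x => by
          rw [lintegral_const_mul _ (by fun_prop), lintegral_const_mul _ hH]
        simp only [this]
        rw [lintegral_const_mul _ (by fun_prop), lintegral_mul_const _ hG]

end IsCenteredGaussian

end Bivariate

section Cutoff

open scoped ContDiff

/-- `f` is a Schwartz version of the real function `h`, which is a smooth approximation at scale
`η` of the indicator of `(-∞, u]`, and `g + η` dominates its derivative. -/
structure IsSmoothCutoff (f : 𝓢(ℝ, ℂ)) (h g : ℝ → ℝ) (u η : ℝ) : Prop where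
  coe_eq : ∀ x, f x = (h x : ℂ)
  nonneg : ∀ x, 0 ≤ h x
  le_one : ∀ x, h x ≤ 1
  eq_one : ∀ x, -η⁻¹ ≤ x → x ≤ u → h x = 1
  eq_zero : ∀ x, u + η ≤ x → h x = 0
  measurable : Measurable g
  bound_nonneg : ∀ x, 0 ≤ g x
  bound_eq_zero : ∀ x < u, g x = 0
  lintegral_bound_le : ∫⁻ x, ENNReal.ofReal (g x) ≤ 1
  norm_deriv_le : ∀ x, ‖SchwartzMap.derivCLM ℂ ℂ f x‖ ≤ g x + η

lemma exists_isSmoothCutoff (u : ℝ) {η : ℝ} (hη : 0 < η) :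
    ∃ (f : 𝓢(ℝ, ℂ)) (h g : ℝ → ℝ), IsSmoothCutoff f h g u η := by
  obtain ⟨ψ, hψs, hψc, hψ0, hψ1, hψ⟩ : ∃ ψ : ℝ → ℝ, ContDiff ℝ ∞ ψ ∧ HasCompactSupport ψ ∧
      (∀ x, 0 ≤ ψ x) ∧ (∀ x, ψ x ≤ 1) ∧ ∀ x, |x| ≤ 1 → ψ x = 1 := by
    let b : ContDiffBump (0 : ℝ) := ⟨1, 2, one_pos, one_lt_two⟩
    exact ⟨b, b.contDiff, b.hasCompactSupport, fun _ => b.nonneg, fun _ => b.le_one,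
      fun x hx => b.one_of_mem_closedBall (by simpa using hx)⟩
  obtain ⟨C, hC⟩ := (hψs.continuous_deriv (by simp)).bounded_above_of_compact_support
    hψc.deriv
  obtain ⟨M, hM1, hM2, hM3⟩ : ∃ M, η⁻¹ ≤ M ∧ u ≤ M ∧ C / η ≤ M :=
    ⟨max η⁻¹ (max u (C / η)), by simp, by simp, by simp⟩
  have hM : 0 < M := (inv_pos.2 hη).trans_le hM1
  let T : ℝ → ℝ := fun x => Real.smoothTransition ((x - u) / η)
  have hTs : ContDiff ℝ ∞ T := Real.smoothTransition.contDiff.comp (by fun_prop)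
  have hT0 : ∀ x ≤ u, T x = 0 := fun x hx =>
    Real.smoothTransition.zero_of_nonpos (div_nonpos_of_nonpos_of_nonneg (by linarith) hη.le)
  have hT1 : ∀ x, u + η ≤ x → T x = 1 := fun x hx =>
    Real.smoothTransition.one_of_one_le ((one_le_div hη).2 (by linarith))
  have hTn : ∀ x, 0 ≤ T x := fun x => Real.smoothTransition.nonneg _
  have hTl : ∀ x, T x ≤ 1 := fun x => Real.smoothTransition.le_one _
  have hTm : Monotone T := fun x y hxy =>
    Real.smoothTransition.monotone (div_le_div_of_nonneg_right (by linarith) hη.le)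
  have hTd : ∀ x, HasDerivAt T (deriv T x) x := fun x =>
    (hTs.differentiable (by simp) x).hasDerivAt
  have hTdc : Continuous (deriv T) := hTs.continuous_deriv (by simp)
  have hTd0 : ∀ x < u, deriv T x = 0 := fun x hx => by
    have : T =ᶠ[nhds x] fun _ => 0 := by
      filter_upwards [Iio_mem_nhds hx] with y hy using hT0 y (le_of_lt hy)
    rw [this.deriv_eq, deriv_const]
  have hTd1 : ∀ x, u + η < x → deriv T x = 0 := fun x hx => by
    have : T =ᶠ[nhds x] fun _ => 1 := by
      filter_upwards [Ioi_mem_nhds hx] with y hy using hT1 y (le_of_lt hy)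
    rw [this.deriv_eq, deriv_const]
  let h : ℝ → ℝ := fun x => (1 - T x) * ψ (x / M)
  have hh : ContDiff ℝ ∞ h := (contDiff_const.sub hTs).mul (hψs.comp (by fun_prop))
  have hd : ∀ x, HasDerivAt h
      (-deriv T x * ψ (x / M) + (1 - T x) * (deriv ψ (x / M) * (1 / M))) x :=
    fun x => ((hTd x).const_sub 1).mul
      (HasDerivAt.comp x (hψs.differentiable (by simp) (x / M)).hasDerivAt
        ((hasDerivAt_id x).div_const M))
  have hcs : HasCompactSupport fun x => (h x : ℂ) := by
    have h1 : HasCompactSupport fun x => ψ (x / M) := by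
      have := hψc.comp_homeomorph
        (Homeomorph.mulRight₀ M⁻¹ (inv_pos.2 hM).ne')
      simpa [Function.comp_def, div_eq_mul_inv] using this
    exact (h1.mul_left (f := fun x => 1 - T x)).comp_left (g := Complex.ofReal) Complex.ofReal_zero
  have hsm : ContDiff ℝ ∞ fun x => (h x : ℂ) := Complex.ofRealCLM.contDiff.comp hh
  refine ⟨hcs.toSchwartzMap hsm, h, deriv T, fun x => rfl, fun x => ?_, fun x => ?_,
    fun x hx1 hx2 => ?_, fun x hx => ?_, hTdc.measurable, fun x => hTm.deriv_nonneg, hTd0, ?_,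
    fun x => ?_⟩
  · exact mul_nonneg (by linarith [hTl x]) (hψ0 _)
  · exact mul_le_one₀ (by linarith [hTn x]) (hψ0 _) (hψ1 _)
  · have : ψ (x / M) = 1 := by
      refine hψ _ (abs_le.2 ?_)
      exact ⟨by rw [le_div_iff₀ hM]; linarith, by rw [div_le_iff₀ hM]; linarith⟩
    simp [h, hT0 x hx2, this]
  · simp [h, hT1 x hx]
  · have hsupp : ∀ x, x ∉ Set.Ioc (u - 1) (u + η + 1) → deriv T x = 0 := fun x hx => by
      rcases le_or_gt x (u - 1) with hx' | hx'
      · exact hTd0 x (by linarith)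
      · exact hTd1 x (by
          by_contra! hcon
          exact hx ⟨hx', by linarith⟩)
    have hval_int : Integrable (deriv T) := by
      refine hTdc.integrable_of_hasCompactSupport
        (HasCompactSupport.intro (isCompact_Icc (a := u - 1) (b := u + η + 1)) fun x hx => ?_)
      exact hsupp x fun hx' => hx (Set.Ioc_subset_Icc_self hx')
    rw [← ofReal_integral_eq_lintegral_ofReal hval_int (.of_forall fun x => hTm.deriv_nonneg),
      ← setIntegral_eq_integral_of_forall_compl_eq_zero hsupp,
      ← intervalIntegral.integral_of_le (by linarith),
      intervalIntegral.integral_deriv_eq_sub' T rfl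
        (fun x _ => (hTd x).differentiableAt) hTdc.continuousOn,
      hT1 _ (by linarith), hT0 _ (by linarith)]
    simp
  · have e : SchwartzMap.derivCLM ℂ ℂ (hcs.toSchwartzMap hsm) x =
        deriv (fun x => (h x : ℂ)) x := rfl
    rw [e, (hd x).ofReal_comp.deriv, Complex.norm_real, Real.norm_eq_abs]
    have h1 : |(-deriv T x) * ψ (x / M)| ≤ deriv T x := by
      rw [abs_mul, abs_neg, abs_of_nonneg hTm.deriv_nonneg, abs_of_nonneg (hψ0 _)]
      exact mul_le_of_le_one_right hTm.deriv_nonneg (hψ1 _)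
    have h2 : |(1 - T x) * (deriv ψ (x / M) * (1 / M))| ≤ η := by
      rw [abs_mul, abs_mul, abs_of_nonneg (by linarith [hTl x]), abs_of_pos (one_div_pos.2 hM)]
      have h3 : |deriv ψ (x / M)| * (1 / M) ≤ η := by
        rw [mul_one_div, div_le_iff₀ hM]
        rw [div_le_iff₀ hη] at hM3
        linarith [hC (x / M), Real.norm_eq_abs (deriv ψ (x / M))]
      exact (mul_le_of_le_one_left (by positivity) (by linarith [hTn x])).trans h3
    exact (abs_add_le _ _).trans (add_le_add h1 h2)

end Cutoff

section Comparison

lemma abs_sub_le_of_hasDerivAt_le {g g' B B' : ℝ → ℝ} (hg : ContinuousOn g (Set.Icc 0 1))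
    (hB : ContinuousOn B (Set.Icc 0 1)) (hg' : ∀ t ∈ Set.Ioo (0 : ℝ) 1, HasDerivAt g (g' t) t)
    (hB' : ∀ t ∈ Set.Ioo (0 : ℝ) 1, HasDerivAt B (B' t) t)
    (hle : ∀ t ∈ Set.Ioo (0 : ℝ) 1, |g' t| ≤ B' t) : |g 1 - g 0| ≤ B 1 - B 0 := by
  have h0 : (0 : ℝ) ∈ Set.Icc (0 : ℝ) 1 := by simp
  have h1 : (1 : ℝ) ∈ Set.Icc (0 : ℝ) 1 := by simp
  have hm : MonotoneOn (fun t => B t - g t) (Set.Icc 0 1) := by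
    refine monotoneOn_of_deriv_nonneg (convex_Icc 0 1) (hB.sub hg) ?_ ?_ <;> rw [interior_Icc]
    · exact fun t ht => ((hB' t ht).sub (hg' t ht)).differentiableAt.differentiableWithinAt
    · intro t ht
      rw [((hB' t ht).fun_sub (hg' t ht)).deriv]
      linarith [hle t ht, le_abs_self (g' t)]
  have hp : MonotoneOn (fun t => B t + g t) (Set.Icc 0 1) := by
    refine monotoneOn_of_deriv_nonneg (convex_Icc 0 1) (hB.add hg) ?_ ?_ <;> rw [interior_Icc]
    · exact fun t ht => ((hB' t ht).add (hg' t ht)).differentiableAt.differentiableWithinAt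
    · intro t ht
      rw [((hB' t ht).fun_add (hg' t ht)).deriv]
      linarith [hle t ht, neg_abs_le (g' t)]
  have := hm h0 h1 zero_le_one
  have := hp h0 h1 zero_le_one
  rw [abs_le]
  constructor <;> linarith

lemma biNormalPDF_nonneg (x y ρ : ℝ) : 0 ≤ biNormalPDF x y ρ := by
  unfold biNormalPDF
  positivity

lemma continuousAt_biNormalPDF (x y : ℝ) {ρ : ℝ} (hρ : |ρ| < 1) :
    ContinuousAt (fun l => biNormalPDF x y l) ρ := by
  obtain ⟨h1, h2⟩ := abs_lt.1 hρ
  have hpos : 0 < 1 - ρ ^ 2 := by nlinarith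
  unfold biNormalPDF
  refine ContinuousAt.mul (ContinuousAt.inv₀ (by fun_prop) (by positivity))
    (Real.continuous_exp.continuousAt.comp (ContinuousAt.div (by fun_prop) (by fun_prop) ?_))
  positivity

lemma abs_convex_combination_lt_one {r s t : ℝ} (hr : |r| < 1) (hs : |s| < 1)
    (ht : t ∈ Set.Icc (0 : ℝ) 1) : |t * r + (1 - t) * s| < 1 := by
  have := (convex_ball (0 : ℝ) 1) (by simpa using hr : r ∈ Metric.ball (0 : ℝ) 1)
    (by simpa using hs : s ∈ Metric.ball (0 : ℝ) 1) ht.1 (by linarith [ht.2] : 0 ≤ 1 - t) (by ring)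
  simpa using this

lemma hasDerivAt_integral_biNormalPDF (u : ℝ) {r s t : ℝ} (hr : |r| < 1) (hs : |s| < 1)
    (ht : t ∈ Set.Icc (0 : ℝ) 1) :
    HasDerivAt (fun t => ∫ l in s..(t * r + (1 - t) * s), biNormalPDF u u l)
      (biNormalPDF u u (t * r + (1 - t) * s) * (r - s)) t := by
  have hρ := abs_convex_combination_lt_one hr hs ht
  have hmem : ∀ l : ℝ, |l| < 1 → l ∈ Set.Ioo (-1 : ℝ) 1 := fun l hl => abs_lt.1 hl
  have hcont : ContinuousOn (fun l => biNormalPDF u u l) (Set.Ioo (-1) 1) := fun l hl =>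
    (continuousAt_biNormalPDF u u (abs_lt.2 hl)).continuousWithinAt
  have hsub : Set.uIcc s (t * r + (1 - t) * s) ⊆ Set.Ioo (-1) 1 :=
    Set.OrdConnected.uIcc_subset Set.ordConnected_Ioo (hmem _ hs) (hmem _ hρ)
  have h1 := intervalIntegral.integral_hasDerivAt_right
    (hcont.mono hsub).intervalIntegrable
    (hcont.stronglyMeasurableAtFilter isOpen_Ioo _ (hmem _ hρ))
    (continuousAt_biNormalPDF u u hρ)
  have h2 : HasDerivAt (fun t : ℝ => t * r + (1 - t) * s) (r - s) t :=
    (((hasDerivAt_id t).mul_const r).add (((hasDerivAt_id t).const_sub 1).mul_const s)).congr_deriv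
      (by ring)
  exact HasDerivAt.comp t h1 h2

lemma IsCenteredGaussian.norm_integral_prod_derivPair_le {N : ℕ} {S : Matrix (Fin N) (Fin N) ℝ}
    {P : Measure (Fin N → ℝ)} [IsProbabilityMeasure P] (hP : IsCenteredGaussian S P)
    {i j : Fin N} {ρ u η : ℝ} (hij : i ≠ j) (hi : S i i = 1) (hj : S j j = 1)
    (hSij : S i j = ρ) (hSji : S j i = ρ) (hρ : |ρ| < 1) (hu : 0 ≤ u) (hη : 0 ≤ η)
    {v : Fin N → ℝ} (hv : ∀ k, u ≤ v k) {f : Fin N → 𝓢(ℝ, ℂ)} {h g : Fin N → ℝ → ℝ}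
    (hf : ∀ k, IsSmoothCutoff (f k) (h k) (g k) (v k) η) :
    ‖∫ x, ∏ k, derivPair f i j k (x k) ∂P‖ ≤ biNormalPDF u u ρ + (2 * η + η ^ 2) := by
  have hφ := biNormalPDF_nonneg u u ρ
  have hpt : ∀ x : Fin N → ℝ, ‖∏ k, derivPair f i j k (x k)‖
      ≤ (g i (x i) + η) * (g j (x j) + η) := by
    intro x
    rw [norm_prod, ← Finset.mul_prod_erase _ _ (Finset.mem_univ i),
      ← Finset.mul_prod_erase _ _ (Finset.mem_erase.2 ⟨hij.symm, Finset.mem_univ j⟩), ← mul_assoc]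
    have e : ∏ k ∈ (Finset.univ.erase i).erase j, ‖derivPair f i j k (x k)‖ ≤ 1 := by
      refine Finset.prod_le_one (fun _ _ => norm_nonneg _) fun k hk => ?_
      simp only [Finset.mem_erase, Finset.mem_univ, and_true] at hk
      simp only [derivPair, hk.1, hk.2, or_self, if_false]
      rw [(hf k).coe_eq, Complex.norm_real, Real.norm_eq_abs, abs_of_nonneg ((hf k).nonneg _)]
      exact (hf k).le_one _
    refine (mul_le_of_le_one_right (by positivity) e).trans ?_
    have ei : derivPair f i j i = SchwartzMap.derivCLM ℂ ℂ (f i) := by simp [derivPair]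
    have ej : derivPair f i j j = SchwartzMap.derivCLM ℂ ℂ (f j) := by simp [derivPair]
    rw [ei, ej]
    exact mul_le_mul ((hf i).norm_deriv_le _) ((hf j).norm_deriv_le _) (norm_nonneg _)
      (add_nonneg ((hf i).bound_nonneg _) hη)
  let G : Fin N → ℝ → ENNReal := fun k y => ENNReal.ofReal (g k y)
  have hG : ∀ k, Measurable (G k) := fun k => (hf k).measurable.ennreal_ofReal
  have hGu : ∀ k, ∀ y < u, G k y = 0 := fun k y hy => by
    simp [G, (hf k).bound_eq_zero y (hy.trans_le (hv k))]
  have hGi : ∀ k, Measurable fun x : Fin N → ℝ => G k (x k) := fun k =>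
    (hG k).comp (measurable_pi_apply k)
  have key : ∫⁻ x, ENNReal.ofReal ‖∏ k, derivPair f i j k (x k)‖ ∂P
      ≤ ENNReal.ofReal (biNormalPDF u u ρ + (2 * η + η ^ 2)) := by
    calc ∫⁻ x, ENNReal.ofReal ‖∏ k, derivPair f i j k (x k)‖ ∂P
        ≤ ∫⁻ x, (G i (x i) * G j (x j) + (ENNReal.ofReal η * G i (x i) +
            (ENNReal.ofReal η * G j (x j) + ENNReal.ofReal η * ENNReal.ofReal η))) ∂P := by
          refine lintegral_mono fun x => (ENNReal.ofReal_le_ofReal (hpt x)).trans_eq ?_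
          rw [ENNReal.ofReal_mul (add_nonneg ((hf i).bound_nonneg _) hη),
            ENNReal.ofReal_add ((hf i).bound_nonneg _) hη,
            ENNReal.ofReal_add ((hf j).bound_nonneg _) hη]
          ring
      _ = ∫⁻ x, G i (x i) * G j (x j) ∂P + (ENNReal.ofReal η * ∫⁻ x, G i (x i) ∂P +
            (ENNReal.ofReal η * ∫⁻ x, G j (x j) ∂P + ENNReal.ofReal η * ENNReal.ofReal η)) := by
          have hGij : Measurable fun x : Fin N → ℝ => G i (x i) * G j (x j) := (hGi i).mul (hGi j)
          rw [lintegral_add_left hGij, lintegral_add_left ((hGi i).const_mul _),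
            lintegral_add_left ((hGi j).const_mul _), lintegral_const_mul _ (hGi i),
            lintegral_const_mul _ (hGi j), lintegral_const, measure_univ, mul_one]
      _ ≤ ENNReal.ofReal (biNormalPDF u u ρ) * (1 * 1) + (ENNReal.ofReal η * 1 +
            (ENNReal.ofReal η * 1 + ENNReal.ofReal η * ENNReal.ofReal η)) := by
          gcongr
          · refine (hP.lintegral_pair_le hi hj hSij hSji hρ hu (hG i) (hG j) (hGu i)
              (hGu j)).trans ?_
            gcongr
            · exact (hf i).lintegral_bound_le
            · exact (hf j).lintegral_bound_le
          · exact (hP.lintegral_le hi (hG i)).trans (hf i).lintegral_bound_le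
          · exact (hP.lintegral_le hj (hG j)).trans (hf j).lintegral_bound_le
      _ = ENNReal.ofReal (biNormalPDF u u ρ + (2 * η + η ^ 2)) := by
          rw [mul_one, mul_one, mul_one, ← ENNReal.ofReal_mul hη,
            ← ENNReal.ofReal_add hη (by positivity),
            ← ENNReal.ofReal_add hη (by positivity), ← ENNReal.ofReal_add hφ (by positivity)]
          congr 1
          ring
  refine (norm_integral_le_lintegral_norm _).trans ?_
  exact ENNReal.toReal_le_of_le_ofReal (by positivity) key

variable {N : ℕ} {S T : Matrix (Fin N) (Fin N) ℝ} {P Q : Measure (Fin N → ℝ)}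

lemma abs_integral_prod_cutoff_sub_le [IsProbabilityMeasure P] [IsProbabilityMeasure Q]
    (hP : IsCenteredGaussian S P) (hQ : IsCenteredGaussian T Q)
    (hS : S.IsSymm) (hT : T.IsSymm) (hdS : ∀ i, S i i = 1) (hdT : ∀ i, T i i = 1)
    (hltS : ∀ i j, i ≠ j → |S i j| < 1) (hltT : ∀ i j, i ≠ j → |T i j| < 1)
    {u η : ℝ} (hu : 0 ≤ u) (hη : 0 ≤ η) {v : Fin N → ℝ} (hv : ∀ k, u ≤ v k)
    {f : Fin N → 𝓢(ℝ, ℂ)} {h g : Fin N → ℝ → ℝ}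
    (hf : ∀ k, IsSmoothCutoff (f k) (h k) (g k) (v k) η) :
    |∫ x, ∏ k, h k (x k) ∂P - ∫ x, ∏ k, h k (x k) ∂Q|
      ≤ ∑ i, ∑ j, (if i ≠ j then (|∫ l in (T i j)..(S i j), biNormalPDF u u l|
          + |S i j - T i j| * (2 * η + η ^ 2)) / 2 else 0) := by
  let σ : Fin N → Fin N → ℝ := fun i j => (SignType.sign (S i j - T i j) : ℝ)
  have hσ : ∀ i j, σ i j * (S i j - T i j) = |S i j - T i j| := fun i j => sign_mul_self _
  have hσ1 : ∀ i j, |σ i j| ≤ 1 := fun i j => by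
    rcases lt_trichotomy (S i j - T i j) 0 with h | h | h <;> simp [σ, h]
  let B : ℝ → ℝ := fun t => ∑ i, ∑ j, if i ≠ j then
    (σ i j * (∫ l in (T i j)..(t * S i j + (1 - t) * T i j), biNormalPDF u u l)
      + |S i j - T i j| * (2 * η + η ^ 2) * t) / 2 else 0
  let B' : ℝ → ℝ := fun t => ∑ i, ∑ j, if i ≠ j then
    |S i j - T i j| / 2 * (biNormalPDF u u (t * S i j + (1 - t) * T i j) + (2 * η + η ^ 2)) else 0
  have hB : ∀ t ∈ Set.Icc (0 : ℝ) 1, HasDerivAt B (B' t) t := by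
    intro t ht
    refine HasDerivAt.fun_sum fun i _ => HasDerivAt.fun_sum fun j _ => ?_
    by_cases hij : i ≠ j
    · simp only [hij, if_true, ne_eq, not_false_eq_true]
      refine ((((hasDerivAt_integral_biNormalPDF u (hltS i j hij) (hltT i j hij) ht).const_mul
        (σ i j)).add ((hasDerivAt_id t).const_mul (|S i j - T i j| * (2 * η + η ^ 2)))).div_const
        2).congr_deriv ?_
      rw [← hσ]
      ring
    · simp only [hij, if_false]
      exact hasDerivAt_const t 0
  have hcont := continuousOn_interpolant f (fun c => (hP c).1) (fun c => (hQ c).1)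
  have hder := fun t ht => hasDerivAt_interpolant f (t := t) (fun c => (hP c).1)
    (fun c => (hQ c).1) (fun i => (hdS i).trans (hdT i).symm) ht
  have hbound : ∀ t ∈ Set.Ioo (0 : ℝ) 1, |(∑ i, ∑ j, ((S - T) i j / 2 : ℂ) *
      interpolant (derivPair f i j) S T t).re| ≤ B' t := by
    intro t ht
    obtain ⟨W, hW1, hW⟩ := hP.exists_convex_combination hQ (Set.Ioo_subset_Icc_self ht)
    refine (Complex.abs_re_le_norm _).trans ?_
    refine (norm_sum_le _ _).trans (Finset.sum_le_sum fun i _ => ?_)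
    refine (norm_sum_le _ _).trans (Finset.sum_le_sum fun j _ => ?_)
    by_cases hij : i ≠ j
    · simp only [hij, if_true, ne_eq, not_false_eq_true]
      have hval_int : interpolant (derivPair f i j) S T t = ∫ x, ∏ k, derivPair f i j k (x k) ∂W :=
        (hW.integral_prod_schwartz _).symm
      have hle := hW.norm_integral_prod_derivPair_le (f := f) (h := h) (g := g) (v := v)
        (u := u) (ρ := t * S i j + (1 - t) * T i j) hij (by simp [hdS, hdT]) (by simp [hdS, hdT])
        (by simp) (by simp [hS.apply i j, hT.apply i j])
        (abs_convex_combination_lt_one (hltS i j hij) (hltT i j hij) (Set.Ioo_subset_Icc_self ht))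
        hu hη hv hf
      rw [norm_mul, hval_int]
      refine mul_le_mul (le_of_eq ?_) hle (norm_nonneg _) (by positivity)
      rw [norm_div, Complex.norm_real, Real.norm_eq_abs, Matrix.sub_apply]
      simp
    · obtain rfl : i = j := not_not.1 hij
      simp [hdS, hdT]
  have hval : ∀ (V : Matrix (Fin N) (Fin N) ℝ) (W : Measure (Fin N → ℝ)) [IsProbabilityMeasure W]
      (t : ℝ), IsCenteredGaussian V W → t • S + (1 - t) • T = V →
      (interpolant f S T t).re = ∫ x, ∏ k, h k (x k) ∂W := by
    intro V W _ t hW hV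
    have e : ∀ x : Fin N → ℝ, ∏ k, f k (x k) = ((∏ k, h k (x k) : ℝ) : ℂ) := fun x => by
      rw [Complex.ofReal_prod]
      exact Finset.prod_congr rfl fun k _ => (hf k).coe_eq _
    rw [interpolant, hV, ← hW.integral_prod_schwartz f]
    simp only [e]
    rw [integral_complex_ofReal, Complex.ofReal_re]
  have hmain := abs_sub_le_of_hasDerivAt_le (g := fun t => (interpolant f S T t).re)
    (Complex.continuous_re.comp_continuousOn hcont)
    (fun t ht => (hB t ht).continuousAt.continuousWithinAt)
    (fun t ht => Complex.reCLM.hasFDerivAt.comp_hasDerivAt t (hder t ht))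
    (fun t ht => hB t (Set.Ioo_subset_Icc_self ht)) hbound
  rw [hval S P 1 hP (by simp), hval T Q 0 hQ (by simp)] at hmain
  refine hmain.trans ?_
  have hB0 : B 0 = 0 := by simp [B]
  rw [hB0, sub_zero]
  refine Finset.sum_le_sum fun i _ => Finset.sum_le_sum fun j _ => ?_
  by_cases hij : i ≠ j
  · simp only [hij, if_true, ne_eq, not_false_eq_true, one_mul, sub_self, zero_mul, add_zero,
      mul_one]
    gcongr
    refine (le_abs_self _).trans ?_
    rw [abs_mul]
    exact mul_le_of_le_one_left (abs_nonneg _) (hσ1 i j)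
  · simp only [hij, if_false, le_refl]

lemma tendsto_integral_prod_cutoff [IsProbabilityMeasure P] {v : Fin N → ℝ} {η : ℕ → ℝ}
    (hη : ∀ n, 0 < η n)
    (hη0 : Filter.Tendsto η Filter.atTop (nhds 0)) {f : ℕ → Fin N → 𝓢(ℝ, ℂ)}
    {h g : ℕ → Fin N → ℝ → ℝ} (hf : ∀ n k, IsSmoothCutoff (f n k) (h n k) (g n k) (v k) (η n)) :
    Filter.Tendsto (fun n => ∫ x, ∏ k, h n k (x k) ∂P) Filter.atTop
      (nhds (P {y | ∀ j, y j ≤ v j}).toReal) := by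
  have hA : MeasurableSet {y : Fin N → ℝ | ∀ j, y j ≤ v j} := by
    rw [Set.ofPred_forall]
    exact MeasurableSet.iInter fun j => measurableSet_le (measurable_pi_apply j) measurable_const
  have hm : ∀ n k, Measurable (h n k) := fun n k => by
    have : h n k = fun x => (f n k x).re := funext fun x => by simp [(hf n k).coe_eq]
    rw [this]
    exact Complex.measurable_re.comp (f n k).continuous.measurable
  have hη' : Filter.Tendsto (fun n => (η n)⁻¹) Filter.atTop Filter.atTop :=
    Filter.Tendsto.inv_tendsto_nhdsGT_zero (tendsto_nhdsWithin_iff.2 ⟨hη0, .of_forall hη⟩)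
  have e : (P {y | ∀ j, y j ≤ v j}).toReal
      = ∫ x, Set.indicator {y : Fin N → ℝ | ∀ j, y j ≤ v j} (fun _ => (1 : ℝ)) x ∂P := by
    rw [integral_indicator hA]
    simp [Measure.real]
  rw [e]
  refine tendsto_integral_of_dominated_convergence (fun _ => 1) (fun n => ?_)
    (integrable_const _) (fun n => .of_forall fun x => ?_) (.of_forall fun x => ?_)
  · exact (Finset.measurable_prod _ fun k _ =>
      (hm n k).comp (measurable_pi_apply k)).aestronglyMeasurable
  · rw [Real.norm_eq_abs, abs_of_nonneg (Finset.prod_nonneg fun k _ => (hf n k).nonneg _)]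
    exact Finset.prod_le_one (fun k _ => (hf n k).nonneg _) fun k _ => (hf n k).le_one _
  · refine tendsto_const_nhds.congr' ?_
    by_cases hx : ∀ j, x j ≤ v j
    · rw [Set.indicator_of_mem (by exact hx)]
      filter_upwards [Filter.eventually_all.2 fun k => hη'.eventually_ge_atTop (-x k)] with n hn
      exact (Finset.prod_eq_one fun k _ =>
        (hf n k).eq_one _ (by linarith [hn k]) (hx k)).symm
    · rw [Set.indicator_of_notMem (by exact hx)]
      push Not at hx
      obtain ⟨k, hk⟩ := hx
      filter_upwards [hη0.eventually_le_const (sub_pos.2 hk)] with n hn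
      exact (Finset.prod_eq_zero (Finset.mem_univ k)
        ((hf n k).eq_zero _ (by linarith))).symm

lemma abs_measure_le_sub_le [IsProbabilityMeasure P] [IsProbabilityMeasure Q]
    (hP : IsCenteredGaussian S P) (hQ : IsCenteredGaussian T Q)
    (hS : S.IsSymm) (hT : T.IsSymm) (hdS : ∀ i, S i i = 1) (hdT : ∀ i, T i i = 1)
    (hltS : ∀ i j, i ≠ j → |S i j| < 1) (hltT : ∀ i j, i ≠ j → |T i j| < 1)
    {u : ℝ} (hu : 0 ≤ u) {v : Fin N → ℝ} (hv : ∀ k, u ≤ v k) :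
    |(P {y | ∀ j, y j ≤ v j}).toReal - (Q {y | ∀ j, y j ≤ v j}).toReal|
      ≤ ∑ i, ∑ j, (if i ≠ j then |∫ l in (T i j)..(S i j), biNormalPDF u u l| / 2 else 0) := by
  let η : ℕ → ℝ := fun n => 1 / ((n : ℝ) + 1)
  have hη : ∀ n, 0 < η n := fun n => Nat.one_div_pos_of_nat
  have hη0 : Filter.Tendsto η Filter.atTop (nhds 0) := tendsto_one_div_add_atTop_nhds_zero_nat
  choose f h g hf using fun (n : ℕ) (k : Fin N) => exists_isSmoothCutoff (v k) (hη n)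
  have hl := ((tendsto_integral_prod_cutoff (P := P) hη hη0 hf).sub
    (tendsto_integral_prod_cutoff (P := Q) hη hη0 hf)).abs
  refine le_of_tendsto_of_tendsto' hl ?_ fun n =>
    abs_integral_prod_cutoff_sub_le hP hQ hS hT hdS hdT hltS hltT hu (hη n).le hv (hf n)
  refine tendsto_finsetSum _ fun i _ => tendsto_finsetSum _ fun j _ => ?_
  by_cases hij : i ≠ j
  · simp only [hij, if_true, ne_eq, not_false_eq_true]
    have hr : Filter.Tendsto (fun n => (|∫ l in (T i j)..(S i j), biNormalPDF u u l|
        + |S i j - T i j| * (2 * η n + η n ^ 2)) / 2) Filter.atTop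
        (nhds ((|∫ l in (T i j)..(S i j), biNormalPDF u u l|
          + |S i j - T i j| * (2 * 0 + 0 ^ 2)) / 2)) :=
      ((((hη0.const_mul 2).add (hη0.pow 2)).const_mul _).const_add _).div_const _
    simpa using hr
  · simp only [hij, if_false]
    exact tendsto_const_nhds

end Comparison

/-- Lemma A4 of Bickel–Rosenblatt: Let `N ≥ 1`, `Σ₁ = (r_{ij})`,
`Σ₂ = (s_{ij})` be `N×N` positive semidefinite with unit diagonals and off-diagonal
entries of modulus `< 1`. Let `P₁, P₂` be the laws on `ℝ^N` of centered Gaussian vectors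
with covariance `Σ₁, Σ₂` (encoded via linear combinations). Let `u_1,…,u_N ≥ 0` and
`u = min_j u_j`. Then
`|P₁(∀j, x_j ≤ u_j) − P₂(∀j, x_j ≤ u_j)| ≤ 4 ∑_{i≠j} |∫_{s_{ij}}^{r_{ij}} φ₂(u,u,λ) dλ|`. -/
theorem stmt3 (N : ℕ) (hN : 1 ≤ N) (S1 S2 : Matrix (Fin N) (Fin N) ℝ)
    (hS1 : S1.PosSemidef) (hS2 : S2.PosSemidef)
    (hd1 : ∀ i, S1 i i = 1) (hd2 : ∀ i, S2 i i = 1)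
    (hlt1 : ∀ i j, i ≠ j → |S1 i j| < 1) (hlt2 : ∀ i j, i ≠ j → |S2 i j| < 1)
    (P1 P2 : Measure (Fin N → ℝ)) [IsProbabilityMeasure P1] [IsProbabilityMeasure P2]
    (hP1 : ∀ c : Fin N → ℝ,
      Measure.map (fun y => ∑ i, c i * y i) P1
        = gaussianReal 0 (Real.toNNReal (∑ i, ∑ j, c i * c j * S1 i j)))
    (hP2 : ∀ c : Fin N → ℝ,
      Measure.map (fun y => ∑ i, c i * y i) P2
        = gaussianReal 0 (Real.toNNReal (∑ i, ∑ j, c i * c j * S2 i j)))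
    (u : Fin N → ℝ) (hu : ∀ j, 0 ≤ u j) :
    |(P1 {y | ∀ j, y j ≤ u j}).toReal - (P2 {y | ∀ j, y j ≤ u j}).toReal|
      ≤ 4 * ∑ i, ∑ j, (if i ≠ j then
          |∫ lam in (S2 i j)..(S1 i j), biNormalPDF (⨅ k, u k) (⨅ k, u k) lam| else 0) := by
  have : Nonempty (Fin N) := ⟨⟨0, hN⟩⟩
  have hsymm : ∀ {S : Matrix (Fin N) (Fin N) ℝ}, S.PosSemidef → S.IsSymm := fun hS => by
    simpa [Matrix.IsHermitian, Matrix.IsSymm, Matrix.conjTranspose_eq_transpose_of_trivial]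
      using hS.isHermitian
  refine (abs_measure_le_sub_le (fun c => ⟨quadForm_nonneg hS1 c, hP1 c⟩)
    (fun c => ⟨quadForm_nonneg hS2 c, hP2 c⟩) (hsymm hS1) (hsymm hS2) hd1 hd2 hlt1 hlt2
    (Real.iInf_nonneg hu) (fun k => ciInf_le (Set.finite_range u).bddBelow k)).trans ?_
  simp only [Finset.mul_sum]
  refine Finset.sum_le_sum fun i _ => Finset.sum_le_sum fun j _ => ?_
  split_ifs
  · linarith [abs_nonneg (∫ l in (S2 i j)..(S1 i j), biNormalPDF (⨅ k, u k) (⨅ k, u k) l)]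
  · simp
end
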